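/- arXiv:1407.1473 — 2 statements merged into one kernel-verified Lean document; each statement's English description precedes it below -/
import Mathlib

section
/- Let S and T be countably infinite Boolean inverse ∧-monoids which are both 0-simplifying and fundamental. Then S and T are isomorphic as inverse monoids if, and only if, their groups of units U(S) and U(T) are isomorphic as groups. -/
universe u

/-- An inverse monoid with zero: every element `a` has a unique generalized
inverse `a⁻¹`, and `0` is an absorbing element. -/
class InverseMonoidWithZero (S : Type u) extends Monoid S, Zero S, Inv S where
  zero_mul' : ∀ a : S, 0 * a = 0
  mul_zero' : ∀ a : S, a * 0 = 0
  mul_inv_mul : ∀ a : S, a * a⁻¹ * a = a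
  inv_mul_inv : ∀ a : S, a⁻¹ * a * a⁻¹ = a⁻¹
  inv_unique : ∀ a b : S, a * b * a = a → b * a * b = b → b = a⁻¹

section BasicDefs

variable {S : Type u}

/-- The natural partial order: `a ≤ b` iff `a = e * b` for some idempotent `e`. -/
def nle [InverseMonoidWithZero S] (a b : S) : Prop :=
  ∃ e : S, e * e = e ∧ a = e * b

/-- `a` and `b` are compatible if `a * b⁻¹` and `a⁻¹ * b` are idempotents. -/
def Compat [InverseMonoidWithZero S] (a b : S) : Prop :=
  (a * b⁻¹) * (a * b⁻¹) = a * b⁻¹ ∧ (a⁻¹ * b) * (a⁻¹ * b) = a⁻¹ * b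

/-- `a` and `b` are orthogonal if `a * b⁻¹ = 0` and `a⁻¹ * b = 0`. -/
def Orth [InverseMonoidWithZero S] (a b : S) : Prop :=
  a * b⁻¹ = 0 ∧ a⁻¹ * b = 0

end BasicDefs

/-- A distributive inverse monoid: every compatible pair has a join (for the
natural partial order), recorded by `sup`, and multiplication distributes over
these binary joins. -/
class DistributiveInverseMonoid (S : Type u) extends InverseMonoidWithZero S where
  sup : S → S → S
  le_sup_left : ∀ a b : S, Compat a b → nle a (sup a b)
  le_sup_right : ∀ a b : S, Compat a b → nle b (sup a b)
  sup_le : ∀ a b c : S, Compat a b → nle a c → nle b c → nle (sup a b) c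
  mul_sup : ∀ a b c : S, Compat a b → c * sup a b = sup (c * a) (c * b)
  sup_mul : ∀ a b c : S, Compat a b → sup a b * c = sup (a * c) (b * c)

/-- A Boolean inverse monoid: a distributive inverse monoid whose idempotents
form a Boolean algebra under the natural partial order; `compl` records the
complementation on idempotents. -/
class BooleanInverseMonoid (S : Type u) extends DistributiveInverseMonoid S where
  compl : S → S
  compl_idem : ∀ e : S, e * e = e → compl e * compl e = compl e
  mul_compl : ∀ e : S, e * e = e → e * compl e = 0
  sup_compl : ∀ e : S, e * e = e → sup e (compl e) = 1

/-- A Boolean inverse ∧-monoid: a Boolean inverse monoid in which every pair of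
elements has a meet with respect to the natural partial order. -/
class BooleanInverseMeetMonoid (S : Type u) extends BooleanInverseMonoid S where
  inf : S → S → S
  inf_le_left : ∀ a b : S, nle (inf a b) a
  inf_le_right : ∀ a b : S, nle (inf a b) b
  le_inf : ∀ a b c : S, nle c a → nle c b → nle c (inf a b)

section MoreDefs

variable {S : Type u}

/-- The join of a compatible pair. -/
def bsup [DistributiveInverseMonoid S] (a b : S) : S := DistributiveInverseMonoid.sup a b

/-- Complementation in the Boolean algebra of idempotents. -/
def bcompl [BooleanInverseMonoid S] (e : S) : S := BooleanInverseMonoid.compl e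

/-- The binary meet. -/
def binf [BooleanInverseMeetMonoid S] (a b : S) : S := BooleanInverseMeetMonoid.inf a b

/-- The fixed-point operator `φ(s) = s ∧ 1`. -/
def phi [BooleanInverseMeetMonoid S] (s : S) : S := binf s 1

/-- The support operator `σ(s) = \overline{φ(s)} ⋅ s⁻¹ s`. -/
def sigma [BooleanInverseMeetMonoid S] (s : S) : S := bcompl (phi s) * (s⁻¹ * s)

/-- An infinitesimal is a non-zero element that squares to zero. -/
def Infinitesimal [InverseMonoidWithZero S] (a : S) : Prop := a ≠ 0 ∧ a * a = 0

/-- A (two-sided) ideal. -/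
def IsMIdeal [InverseMonoidWithZero S] (I : Set S) : Prop :=
  I.Nonempty ∧ ∀ a ∈ I, ∀ s : S, s * a ∈ I ∧ a * s ∈ I

/-- A ∨-ideal: an ideal closed under joins of compatible pairs. -/
def IsVIdeal [DistributiveInverseMonoid S] (I : Set S) : Prop :=
  IsMIdeal I ∧ ∀ a ∈ I, ∀ b ∈ I, Compat a b → bsup a b ∈ I

end MoreDefs

/-- 0-simplifying: the only ∨-ideals are `{0}` and `S`. -/
def ZeroSimplifying (S : Type u) [DistributiveInverseMonoid S] : Prop :=
  ∀ I : Set S, IsVIdeal I → I = {0} ∨ I = Set.univ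

/-- 0-simple: non-trivial and the only ideals are `{0}` and `S`. -/
def ZeroSimple (S : Type u) [InverseMonoidWithZero S] : Prop :=
  (∃ s : S, s ≠ 0) ∧ ∀ I : Set S, IsMIdeal I → I = {0} ∨ I = Set.univ

/-- Fundamental: every element commuting with all idempotents is an idempotent. -/
def Fundamental (S : Type u) [InverseMonoidWithZero S] : Prop :=
  ∀ a : S, (∀ e : S, e * e = e → a * e = e * a) → a * a = a

/-- The Boolean algebra of idempotents is atomless. -/
def IdemAtomless (S : Type u) [InverseMonoidWithZero S] : Prop :=
  ∀ e : S, e * e = e → e ≠ 0 → ∃ f : S, f * f = f ∧ f ≠ 0 ∧ nle f e ∧ f ≠ e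

section Filters

variable {S : Type u}

/-- A filter in a Boolean inverse ∧-monoid: a nonempty subset closed under
binary meets and upward closed in the natural partial order. -/
def IsMFilter [BooleanInverseMeetMonoid S] (A : Set S) : Prop :=
  A.Nonempty ∧ (∀ a ∈ A, ∀ b ∈ A, binf a b ∈ A) ∧ ∀ a ∈ A, ∀ b : S, nle a b → b ∈ A

/-- An ultrafilter: a maximal proper filter. -/
def IsMUltrafilter [BooleanInverseMeetMonoid S] (A : Set S) : Prop :=
  IsMFilter A ∧ (0 : S) ∉ A ∧ ∀ B : Set S, IsMFilter B → (0 : S) ∉ B → A ⊆ B → A = B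

/-- A filter of the Boolean algebra of idempotents (meet of idempotents is
their product). -/
def IsIdemFilter [InverseMonoidWithZero S] (F : Set S) : Prop :=
  F.Nonempty ∧ (∀ e ∈ F, e * e = e) ∧ (∀ e ∈ F, ∀ f ∈ F, e * f ∈ F) ∧
    ∀ e ∈ F, ∀ f : S, f * f = f → nle e f → f ∈ F

/-- An ultrafilter of the Boolean algebra of idempotents. -/
def IsIdemUltrafilter [InverseMonoidWithZero S] (F : Set S) : Prop :=
  IsIdemFilter F ∧ (0 : S) ∉ F ∧
    ∀ G : Set S, IsIdemFilter G → (0 : S) ∉ G → F ⊆ G → F = G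

end Filters

section PencilDefs

variable {S : Type u}

/-- `Preceq e f`: there is a pencil from `e` to `f`, i.e. finitely many
elements `x₁, …, xₘ` with `r(xᵢ) ≤ f` for all `i` and `e = ⋁ d(xᵢ)`
(a least upper bound for the natural partial order). -/
def Preceq [DistributiveInverseMonoid S] (e f : S) : Prop :=
  ∃ l : List S, l ≠ [] ∧ (∀ x ∈ l, nle (x * x⁻¹) f) ∧
    (∀ x ∈ l, nle (x⁻¹ * x) e) ∧ ∀ c : S, (∀ x ∈ l, nle (x⁻¹ * x) c) → nle e c

/-- Piecewise factorizable: every element is a finite join of elements each of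
which lies beneath a unit. -/
def PiecewiseFactorizable (S : Type u) [DistributiveInverseMonoid S] : Prop :=
  ∀ s : S, ∃ l : List S, l ≠ [] ∧ (∀ x ∈ l, ∃ g : S, IsUnit g ∧ nle x g) ∧
    (∀ x ∈ l, nle x s) ∧ ∀ c : S, (∀ x ∈ l, nle x c) → nle s c

/-- A properly infinite idempotent. -/
def ProperlyInfinite [DistributiveInverseMonoid S] (e : S) : Prop :=
  ∃ x y : S, x⁻¹ * x = e ∧ y⁻¹ * y = e ∧ Orth (x * x⁻¹) (y * y⁻¹) ∧
    nle (bsup (x * x⁻¹) (y * y⁻¹)) e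

end PencilDefs

/-- Purely infinite: every non-zero idempotent is properly infinite. -/
def PurelyInfinite (S : Type u) [DistributiveInverseMonoid S] : Prop :=
  ∀ e : S, e * e = e → e ≠ 0 → ProperlyInfinite e

namespace InverseMonoidWithZero

variable {S : Type u} [InverseMonoidWithZero S]

theorem zero_mul_eq (a : S) : 0 * a = 0 := zero_mul' a

theorem mul_zero_eq (a : S) : a * 0 = 0 := mul_zero' a

theorem mul_idem_of_idem {e f : S} (he : e * e = e) (hf : f * f = f) :
    (e * f) * (e * f) = e * f := by
  have h1 := mul_inv_mul (e * f)
  have h2 := inv_mul_inv (e * f)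
  set x := (e * f)⁻¹ with hx
  have h3 : f * x * e = x := inv_unique _ _ (by grind) (by grind)
  have h4 : x * x = x := by grind
  have h5 : x = x⁻¹ := inv_unique _ _ (by grind) (by grind)
  have h6 : e * f = x⁻¹ := inv_unique _ _ h2 h1
  rw [h6, ← h5, h4]

theorem idem_comm {e f : S} (he : e * e = e) (hf : f * f = f) : e * f = f * e := by
  have h1 := mul_idem_of_idem he hf
  have h2 := mul_idem_of_idem hf he
  have h3 : e * f = (e * f)⁻¹ := inv_unique _ _ (by grind) (by grind)
  have h4 : f * e = (e * f)⁻¹ := inv_unique _ _ (by grind) (by grind)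
  rw [h3, ← h4]

theorem inv_of_idem {e : S} (he : e * e = e) : e⁻¹ = e :=
  (inv_unique _ _ (by grind) (by grind)).symm

theorem inv_inv_eq (a : S) : a⁻¹⁻¹ = a :=
  (inv_unique _ _ (inv_mul_inv a) (mul_inv_mul a)).symm

theorem inv_mul_self_idem (a : S) : (a⁻¹ * a) * (a⁻¹ * a) = a⁻¹ * a := by
  have := mul_inv_mul a
  grind

theorem mul_inv_self_idem (a : S) : (a * a⁻¹) * (a * a⁻¹) = a * a⁻¹ := by
  have := mul_inv_mul a
  grind

theorem mul_inv_eq (a b : S) : (a * b)⁻¹ = b⁻¹ * a⁻¹ := by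
  have h := idem_comm (inv_mul_self_idem a) (mul_inv_self_idem b)
  have h1 := mul_inv_mul a
  have h2 := mul_inv_mul b
  have h3 := inv_mul_inv a
  have h4 := inv_mul_inv b
  refine (inv_unique _ _ ?_ ?_).symm
  · calc a * b * (b⁻¹ * a⁻¹) * (a * b) = a * ((b * b⁻¹) * (a⁻¹ * a)) * b := by
          simp only [mul_assoc]
      _ = (a * a⁻¹ * a) * (b * b⁻¹ * b) := by rw [← h]; simp only [mul_assoc]
      _ = a * b := by rw [h1, h2]
  · calc b⁻¹ * a⁻¹ * (a * b) * (b⁻¹ * a⁻¹) = b⁻¹ * ((a⁻¹ * a) * (b * b⁻¹)) * a⁻¹ := by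
          simp only [mul_assoc]
      _ = (b⁻¹ * b * b⁻¹) * (a⁻¹ * a * a⁻¹) := by rw [h]; simp only [mul_assoc]
      _ = b⁻¹ * a⁻¹ := by rw [h3, h4]

theorem zero_idem : (0 : S) * 0 = 0 := zero_mul_eq 0

theorem inv_zero_eq : (0 : S)⁻¹ = 0 := inv_of_idem zero_idem

theorem mul_idem_eq (a : S) {e : S} (he : e * e = e) : a * e = (a * e * a⁻¹) * a := by
  have h := idem_comm he (inv_mul_self_idem a)
  have := mul_inv_mul a
  grind

theorem idem_mul_eq (a : S) {e : S} (he : e * e = e) : e * a = a * (a⁻¹ * e * a) := by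
  have h := idem_comm he (mul_inv_self_idem a)
  have := mul_inv_mul a
  grind

theorem conj_idem (a : S) {e : S} (he : e * e = e) :
    (a * e * a⁻¹) * (a * e * a⁻¹) = a * e * a⁻¹ := by
  have h := mul_idem_eq a he
  grind

theorem conj_inv_idem (a : S) {e : S} (he : e * e = e) :
    (a⁻¹ * e * a) * (a⁻¹ * e * a) = a⁻¹ * e * a := by
  have h := idem_mul_eq a he
  grind

theorem nle_iff {a b : S} : nle a b ↔ a = (a * a⁻¹) * b := by
  constructor
  · rintro ⟨e, he, rfl⟩
    have h := idem_comm he (mul_inv_self_idem b)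
    have := mul_inv_mul b
    rw [mul_inv_eq, inv_of_idem he]
    grind
  · intro h
    exact ⟨_, mul_inv_self_idem a, h⟩

theorem nle_iff' {a b : S} : nle a b ↔ a = b * (a⁻¹ * a) := by
  constructor
  · intro h
    have h0 := nle_iff.1 h
    have h1 : a⁻¹ = b⁻¹ * (a * a⁻¹) := by
      conv_lhs => rw [h0, mul_inv_eq, inv_of_idem (mul_inv_self_idem a)]
    have h2 := idem_mul_eq b (mul_inv_self_idem a)
    rw [← h0] at h2
    conv_lhs => rw [h2]
    conv_rhs => rw [h1]
    have := mul_inv_mul a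
    grind
  · intro h
    refine ⟨b * (a⁻¹ * a) * b⁻¹, conj_idem b (inv_mul_self_idem a), ?_⟩
    rw [← mul_idem_eq b (inv_mul_self_idem a), ← h]

theorem nle_refl (a : S) : nle a a := nle_iff.2 (mul_inv_mul a).symm

theorem nle_antisymm {a b : S} (hab : nle a b) (hba : nle b a) : a = b := by
  obtain ⟨e, he, h1⟩ := hab
  obtain ⟨f, hf, h2⟩ := hba
  have h3 : e * a = a := by rw [h1, ← mul_assoc, he]
  calc a = e * (f * a) := by rw [← h2, ← h1]
    _ = f * (e * a) := by rw [← mul_assoc, idem_comm he hf, mul_assoc]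
    _ = b := by rw [h3, ← h2]

theorem zero_nle (a : S) : nle 0 a := ⟨0, zero_idem, (zero_mul_eq a).symm⟩

theorem nle_one_iff {a : S} : nle a 1 ↔ a * a = a := by
  constructor
  · rintro ⟨e, he, rfl⟩
    simpa using he
  · intro h
    exact ⟨a, h, by simp⟩

theorem nle_idem_iff {e f : S} (he : e * e = e) : nle e f ↔ e = e * f := by
  rw [nle_iff, inv_of_idem he, he]

theorem compat_of_idem {e f : S} (he : e * e = e) (hf : f * f = f) : Compat e f := by
  unfold Compat
  rw [inv_of_idem he, inv_of_idem hf]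
  exact ⟨mul_idem_of_idem he hf, mul_idem_of_idem he hf⟩

theorem compat_of_orth {a b : S} (h : Orth a b) : Compat a b := by
  unfold Compat
  rw [h.1, h.2]
  exact ⟨zero_idem, zero_idem⟩

theorem compat_zero_right (a : S) : Compat a 0 :=
  compat_of_orth ⟨by rw [inv_zero_eq, mul_zero_eq], mul_zero_eq _⟩

theorem compat_zero_left (a : S) : Compat 0 a :=
  compat_of_orth ⟨zero_mul_eq _, by rw [inv_zero_eq, zero_mul_eq]⟩

theorem Compat.mul_left {a b : S} (h : Compat a b) (c : S) : Compat (c * a) (c * b) := by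
  obtain ⟨h1, h2⟩ := h
  constructor
  · rw [mul_inv_eq]
    have := conj_idem c h1
    grind
  · rw [mul_inv_eq]
    have h3 : a⁻¹ * c⁻¹ * (c * b) = (a⁻¹ * (c⁻¹ * c) * a) * (a⁻¹ * b) := by
      have h4 := mul_idem_eq a⁻¹ (inv_mul_self_idem c)
      rw [inv_inv_eq] at h4
      clear h1 h2
      grind
    rw [h3]
    exact mul_idem_of_idem (conj_inv_idem a (inv_mul_self_idem c)) h2

theorem Compat.inv {a b : S} (h : Compat a b) : Compat a⁻¹ b⁻¹ := by
  obtain ⟨h1, h2⟩ := h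
  exact ⟨by rwa [inv_inv_eq], by rwa [inv_inv_eq]⟩

theorem Compat.mul_right {a b : S} (h : Compat a b) (c : S) : Compat (a * c) (b * c) := by
  have h1 := (Compat.mul_left (Compat.inv h) c⁻¹)
  rw [← mul_inv_eq, ← mul_inv_eq] at h1
  have h2 := Compat.inv h1
  rwa [inv_inv_eq, inv_inv_eq] at h2

theorem val_inv_unit (u : Sˣ) : ((u⁻¹ : Sˣ) : S) = (u : S)⁻¹ :=
  inv_unique _ _ (by simp) (by simp)

theorem inv_eq_self_of_sq_one {u : S} (h : u * u = 1) : u⁻¹ = u :=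
  (inv_unique _ _ (by rw [h, one_mul]) (by rw [h, one_mul])).symm

/-- An element whose square is `1`, as a unit. -/
def unitOfSq (u : S) (h : u * u = 1) : Sˣ := ⟨u, u, h, h⟩

end InverseMonoidWithZero

open InverseMonoidWithZero

namespace DistributiveInverseMonoid

variable {S : Type u} [DistributiveInverseMonoid S]

theorem sup_zero_eq (a : S) : sup a 0 = a :=
  nle_antisymm (sup_le _ _ _ (compat_zero_right a) (nle_refl a) (zero_nle a))
    (le_sup_left _ _ (compat_zero_right a))

theorem zero_sup_eq (a : S) : sup 0 a = a :=
  nle_antisymm (sup_le _ _ _ (compat_zero_left a) (zero_nle a) (nle_refl a))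
    (le_sup_right _ _ (compat_zero_left a))

theorem sup_idem {e f : S} (he : e * e = e) (hf : f * f = f) : sup e f * sup e f = sup e f :=
  nle_one_iff.1 (sup_le _ _ _ (compat_of_idem he hf) (nle_one_iff.2 he) (nle_one_iff.2 hf))

theorem sup_mul_self {x y : S} (h : Compat x y) (hxy : x * y = 0) (hyx : y * x = 0) :
    sup x y * sup x y = sup (x * x) (y * y) := by
  rw [mul_sup _ _ _ h, sup_mul _ _ _ h, sup_mul _ _ _ h, hxy, hyx, sup_zero_eq, zero_sup_eq]

theorem sup_eq_mul_sup {a b : S} (h : Compat a b) :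
    sup a b = sup a b * sup (a⁻¹ * a) (b⁻¹ * b) := by
  rw [mul_sup _ _ _ (compat_of_idem (inv_mul_self_idem a) (inv_mul_self_idem b)),
    ← nle_iff'.1 (le_sup_left _ _ h), ← nle_iff'.1 (le_sup_right _ _ h)]

theorem sup_eq_sup_mul {a b : S} (h : Compat a b) :
    sup a b = sup (a * a⁻¹) (b * b⁻¹) * sup a b := by
  rw [sup_mul _ _ _ (compat_of_idem (mul_inv_self_idem a) (mul_inv_self_idem b)),
    ← nle_iff.1 (le_sup_left _ _ h), ← nle_iff.1 (le_sup_right _ _ h)]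

end DistributiveInverseMonoid

/-- A faithful action of a group `G` on a Boolean algebra `B` by automorphisms, such that every
group element has a support in `B`, every nonzero element of `B` contains the support of a
nontrivial involution, involutions can be cut down to invariant elements of `B`, and `B` is
generated by the supports of involutions. -/
structure InvolutiveAction (G B : Type*) [Group G] [BooleanAlgebra B] [MulAction G B] where
  smul_mono : ∀ (g : G) (a b : B), a ≤ b → g • a ≤ g • b
  /-- The support of a group element. -/
  supp : G → B
  disjoint_supp_iff : ∀ (g : G) (e : B), Disjoint e (supp g) ↔ ∀ f ≤ e, g • f = f
  eq_one_of_supp : ∀ g : G, supp g = ⊥ → g = 1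
  exists_involution : ∀ e : B, e ≠ ⊥ → ∃ p : G, p ≠ 1 ∧ p * p = 1 ∧ supp p ≤ e
  exists_cut : ∀ (p : G) (c : B), p * p = 1 → p • c = c →
    ∃ q : G, q * q = 1 ∧ (∀ f ≤ c, q • f = p • f) ∧ ∀ f ≤ cᶜ, q • f = f
  generate : ∀ P : B → Prop, (∀ p : G, p * p = 1 → P (supp p)) → (∀ a, P a → P aᶜ) →
    (∀ a b, P a → P b → P (a ⊓ b)) → ∀ e, P e

section GroupTheory

variable {G H : Type*} [Group G] [Group H]

/-- The involutions commuting with `p` and with all their conjugates by elements of the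
centralizer of `p`. -/
def commutingInvolutions (p : G) : Set G :=
  {x | Commute x p ∧ x * x = 1 ∧ ∀ y, Commute y p → Commute x (y * x * y⁻¹)}

/-- The centralizer of `commutingInvolutions p`. -/
def involutionCentralizer (p : G) : Set G :=
  {x | ∀ y ∈ commutingInvolutions p, Commute x y}

/-- The elements commuting with the squares of the elements of `involutionCentralizer p`. -/
def localGroup (p : G) : Set G :=
  {x | ∀ y ∈ involutionCentralizer p, Commute x (y * y)}

theorem commute_mulEquiv_iff (f : G ≃* H) {x y : G} : Commute (f x) (f y) ↔ Commute x y := by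
  simp only [commute_iff_eq, ← map_mul, f.injective.eq_iff]

theorem map_mem_commutingInvolutions (f : G ≃* H) {p x : G} :
    f x ∈ commutingInvolutions (f p) ↔ x ∈ commutingInvolutions p := by
  simp only [commutingInvolutions, Set.mem_ofPred_eq, f.surjective.forall, ← map_mul, ← map_inv,
    commute_mulEquiv_iff, map_eq_one_iff f f.injective]

theorem map_mem_involutionCentralizer (f : G ≃* H) {p x : G} :
    f x ∈ involutionCentralizer (f p) ↔ x ∈ involutionCentralizer p := by
  simp only [involutionCentralizer, Set.mem_ofPred_eq, f.surjective.forall,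
    map_mem_commutingInvolutions, commute_mulEquiv_iff]

theorem map_mem_localGroup (f : G ≃* H) {p x : G} :
    f x ∈ localGroup (f p) ↔ x ∈ localGroup p := by
  simp only [localGroup, Set.mem_ofPred_eq, f.surjective.forall,
    map_mem_involutionCentralizer, ← map_mul, commute_mulEquiv_iff]

theorem self_mem_commutingInvolutions {p : G} (hpp : p * p = 1) :
    p ∈ commutingInvolutions p :=
  ⟨Commute.refl p, hpp, fun y hy => by rw [hy.eq, mul_inv_cancel_right]⟩

end GroupTheory

namespace InvolutiveAction

variable {G B : Type*} [Group G] [BooleanAlgebra B] [MulAction G B] (A : InvolutiveAction G B)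

theorem smul_le_iff (A : InvolutiveAction G B) (g : G) {a b : B} : g • a ≤ g • b ↔ a ≤ b := by
  refine ⟨fun h => ?_, A.smul_mono g a b⟩
  simpa using A.smul_mono g⁻¹ _ _ h

/-- A group element as an order automorphism. -/
def toOrderIso (g : G) : B ≃o B where
  toEquiv := MulAction.toPerm g
  map_rel_iff' := A.smul_le_iff g

theorem smul_bot (A : InvolutiveAction G B) (g : G) : g • (⊥ : B) = ⊥ := map_bot (A.toOrderIso g)

theorem smul_inf (A : InvolutiveAction G B) (g : G) (a b : B) : g • (a ⊓ b) = g • a ⊓ g • b :=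
  map_inf (A.toOrderIso g) a b

theorem smul_sup (A : InvolutiveAction G B) (g : G) (a b : B) : g • (a ⊔ b) = g • a ⊔ g • b :=
  map_sup (A.toOrderIso g) a b

theorem smul_compl (A : InvolutiveAction G B) (g : G) (a : B) : g • aᶜ = (g • a)ᶜ :=
  map_compl' (A.toOrderIso g) a

theorem smul_eq_bot_iff (A : InvolutiveAction G B) (g : G) {a : B} : g • a = ⊥ ↔ a = ⊥ := by
  rw [smul_eq_iff_eq_inv_smul, A.smul_bot]

theorem smul_disjoint_iff (A : InvolutiveAction G B) (g : G) {a b : B} :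
    Disjoint (g • a) (g • b) ↔ Disjoint a b := by
  rw [disjoint_iff, disjoint_iff, ← A.smul_inf, A.smul_eq_bot_iff]

theorem smul_eq_of_disjoint {g : G} {e : B} (h : Disjoint e (A.supp g)) : g • e = e :=
  (A.disjoint_supp_iff g e).1 h e le_rfl

theorem eq_of_disjoint_iff {a b : B} (h : ∀ e, Disjoint e a ↔ Disjoint e b) : a = b := by
  apply le_antisymm
  · have := (h bᶜ).2 disjoint_compl_left
    exact disjoint_compl_right_iff.1 this.symm
  · have := (h aᶜ).1 disjoint_compl_left
    exact disjoint_compl_right_iff.1 this.symm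

theorem supp_conj (g h : G) : A.supp (g * h * g⁻¹) = g • A.supp h := by
  apply eq_of_disjoint_iff
  intro e
  have h1 : Disjoint e (g • A.supp h) ↔ Disjoint (g⁻¹ • e) (A.supp h) := by
    rw [← A.smul_disjoint_iff g (a := g⁻¹ • e), smul_inv_smul]
  rw [h1, A.disjoint_supp_iff, A.disjoint_supp_iff]
  constructor
  · intro hf f hfe
    have h2 : g • f ≤ e := by rw [← A.smul_le_iff g⁻¹, inv_smul_smul]; exact hfe
    have h3 := hf _ h2
    simp only [mul_smul, inv_smul_smul] at h3
    exact (MulAction.injective g) h3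
  · intro hf f hfe
    have h3 := hf (g⁻¹ • f) (A.smul_mono _ _ _ hfe)
    simp only [mul_smul, h3, smul_inv_smul]

theorem smul_supp_self (g : G) : g • A.supp g = A.supp g := by
  rw [← A.supp_conj, mul_inv_cancel_right]

theorem eq_one_of_smul (A : InvolutiveAction G B) {g : G} (h : ∀ b : B, g • b = b) : g = 1 := by
  apply A.eq_one_of_supp
  have := (A.disjoint_supp_iff g ⊤).2 fun f _ => h f
  exact top_disjoint.1 this

theorem eq_of_smul (A : InvolutiveAction G B) {g h : G} (H : ∀ b : B, g • b = h • b) : g = h := by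
  have : h⁻¹ * g = 1 := A.eq_one_of_smul fun b => by rw [mul_smul, H, inv_smul_smul]
  exact (inv_mul_eq_one.1 this).symm

theorem commute_of_disjoint {g h : G} (H : Disjoint (A.supp g) (A.supp h)) : Commute g h := by
  apply A.eq_of_smul
  intro b
  have h1 : h • A.supp g = A.supp g := A.smul_eq_of_disjoint H
  have h2 : g • h • (b ⊓ A.supp g) = h • g • (b ⊓ A.supp g) := by
    have h3 : h • (b ⊓ A.supp g) = b ⊓ A.supp g :=
      A.smul_eq_of_disjoint (H.mono_left inf_le_right)
    have h4 : h • g • (b ⊓ A.supp g) = g • (b ⊓ A.supp g) := by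
      apply A.smul_eq_of_disjoint (H.mono_left _)
      rw [A.smul_inf, A.smul_supp_self]
      exact inf_le_right
    rw [h3, h4]
  have h5 : g • h • (b ⊓ (A.supp g)ᶜ) = h • g • (b ⊓ (A.supp g)ᶜ) := by
    have h3 : g • (b ⊓ (A.supp g)ᶜ) = b ⊓ (A.supp g)ᶜ :=
      A.smul_eq_of_disjoint (disjoint_compl_left.mono_left inf_le_right)
    have h4 : g • h • (b ⊓ (A.supp g)ᶜ) = h • (b ⊓ (A.supp g)ᶜ) := by
      apply A.smul_eq_of_disjoint (disjoint_compl_left.mono_left _)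
      rw [A.smul_inf, A.smul_compl, h1]
      exact inf_le_right
    rw [h3, h4]
  rw [mul_smul, mul_smul, ← sup_inf_inf_compl (x := b) (y := A.supp g)]
  simp only [A.smul_sup, h2, h5]

theorem exists_disjoint_smul {g : G} {e : B} (h : ¬ Disjoint e (A.supp g)) :
    ∃ f ≠ ⊥, f ≤ e ∧ Disjoint (g • f) f := by
  rw [A.disjoint_supp_iff] at h
  push Not at h
  obtain ⟨f, hfe, hf⟩ := h
  by_cases h1 : f \ (g • f) = ⊥
  · have h2 : f ≤ g • f := sdiff_eq_bot_iff.1 h1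
    refine ⟨f \ (g⁻¹ • f), ?_, sdiff_le.trans hfe, ?_⟩
    · intro h3
      have h4 : f ≤ g⁻¹ • f := sdiff_eq_bot_iff.1 h3
      have h5 := A.smul_mono g _ _ h4
      rw [smul_inv_smul] at h5
      exact hf (le_antisymm h5 h2)
    · rw [sdiff_eq, A.smul_inf, A.smul_compl, smul_inv_smul]
      exact (disjoint_compl_left.mono_left inf_le_right).mono_right inf_le_left
  · refine ⟨_, h1, sdiff_le.trans hfe, ?_⟩
    exact disjoint_sdiff_self_right.mono_left (A.smul_mono _ _ _ sdiff_le)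

theorem exists_disjoint_smul_of_ne_bot {g : G} {e : B} (he : e ≠ ⊥) (h : e ≤ A.supp g) :
    ∃ f ≠ ⊥, f ≤ e ∧ Disjoint (g • f) f :=
  A.exists_disjoint_smul fun hd => he (disjoint_self.1 (hd.mono_right h))

theorem supp_eq_bot_iff {g : G} : A.supp g = ⊥ ↔ g = 1 := by
  refine ⟨A.eq_one_of_supp g, ?_⟩
  rintro rfl
  have := (A.disjoint_supp_iff 1 ⊤).2 fun f _ => one_smul G f
  exact top_disjoint.1 this

theorem eq_one_of_commute {g x : G} {d : B} (hd : Disjoint (g • d) d) (hx : A.supp x ≤ d)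
    (h : Commute g x) : x = 1 := by
  have h1 : A.supp x = g • A.supp x := by
    rw [← A.supp_conj, h.eq, mul_inv_cancel_right]
  have h2 : A.supp x ≤ g • d := by rw [h1]; exact A.smul_mono _ _ _ hx
  rw [← A.supp_eq_bot_iff, ← disjoint_self]
  exact (hd.mono_left h2).mono_right hx

theorem supp_mul_le {g h : G} {e : B} (hg : A.supp g ≤ e) (hh : A.supp h ≤ e) :
    A.supp (g * h) ≤ e := by
  have h1 : Disjoint eᶜ (A.supp (g * h)) := by
    rw [A.disjoint_supp_iff]
    intro f hf
    have hd : Disjoint f e := disjoint_compl_left.mono_left hf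
    rw [mul_smul, A.smul_eq_of_disjoint (hd.mono_right hh),
      A.smul_eq_of_disjoint (hd.mono_right hg)]
  exact disjoint_compl_right_iff.1 h1.symm

theorem exists_sq_ne_one {e : B} (he : e ≠ ⊥) : ∃ x : G, x * x ≠ 1 ∧ A.supp x ≤ e := by
  obtain ⟨p, hp1, hpp, hpe⟩ := A.exists_involution e he
  have hp0 : A.supp p ≠ ⊥ := fun h => hp1 (A.eq_one_of_supp p h)
  obtain ⟨f, hf0, hfp, hfd⟩ := A.exists_disjoint_smul_of_ne_bot hp0 le_rfl
  obtain ⟨q, hq1, hqq, hqf⟩ := A.exists_involution f hf0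
  refine ⟨p * q, fun h => hq1 (A.eq_one_of_commute hfd hqf ?_),
    A.supp_mul_le hpe (hqf.trans (hfp.trans hpe))⟩
  have h1 : p * q = (p * q)⁻¹ := eq_inv_of_mul_eq_one_left h
  rwa [mul_inv_rev, inv_eq_of_mul_eq_one_left hpp, inv_eq_of_mul_eq_one_left hqq] at h1

theorem supp_sq_le (x : G) : A.supp (x * x) ≤ A.supp x := A.supp_mul_le le_rfl le_rfl

theorem supp_le_of_mem_commutingInvolutions {p x : G} (hx : x ∈ commutingInvolutions p) :
    A.supp x ≤ A.supp p := by
  obtain ⟨-, hxx, hx⟩ := hx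
  by_contra hne
  have h1 : ¬ Disjoint (A.supp p)ᶜ (A.supp x) := fun h => hne (disjoint_compl_right_iff.1 h.symm)
  obtain ⟨d, hd0, hdp, hdd⟩ := A.exists_disjoint_smul h1
  obtain ⟨y, hyy, hyd⟩ := A.exists_sq_ne_one hd0
  have hyp : Commute y p := A.commute_of_disjoint
    (disjoint_compl_left.mono_left (hyd.trans hdp))
  have hxi : x⁻¹ = x := inv_eq_of_mul_eq_one_left hxx
  have hconj : A.supp (x * y * x⁻¹) ≤ x • d := by
    rw [A.supp_conj]; exact A.smul_mono _ _ _ hyd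
  have hc : Commute (x * y * x⁻¹) y :=
    A.commute_of_disjoint ((hdd.mono_left hconj).mono_right hyd)
  have h2 := (hx y hyp).eq
  apply hyy
  refine A.eq_one_of_commute hdd ((A.supp_sq_le y).trans hyd) ?_
  have h3 : (x * y * x⁻¹) * y⁻¹ = y * (x * y * x⁻¹)⁻¹ := by
    rw [hxi, mul_inv_rev, mul_inv_rev, hxi]
    simpa only [mul_assoc] using h2
  have h4 : (x * y * x⁻¹) * (x * y * x⁻¹) = y * y := by
    rw [mul_inv_eq_iff_eq_mul] at h3
    have h5 := hc.inv_left.eq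
    calc (x * y * x⁻¹) * (x * y * x⁻¹)
        = y * (x * y * x⁻¹)⁻¹ * y * (x * y * x⁻¹) := by rw [← h3]
      _ = y * y := by rw [mul_assoc y, h5]; group
  have h6 : x * (y * y) * x⁻¹ = y * y := by
    refine Eq.trans ?_ h4
    group
  exact mul_inv_eq_iff_eq_mul.1 h6

theorem cut_mem_commutingInvolutions (A : InvolutiveAction G B) {p q : G} {c : B} (hpc : p • c = c)
    (hqq : q * q = 1) (hqc : ∀ f ≤ c, q • f = p • f) (hqc' : ∀ f ≤ cᶜ, q • f = f) :
    q ∈ commutingInvolutions p := by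
  have hpc' : p • cᶜ = cᶜ := by rw [A.smul_compl, hpc]
  have ext : ∀ {g h : G} (u : B), (∀ f ≤ u, g • f = h • f) → (∀ f ≤ uᶜ, g • f = h • f) →
      g = h := by
    intro g h u h1 h2
    apply A.eq_of_smul
    intro b
    rw [← sup_inf_inf_compl (x := b) (y := u), A.smul_sup, A.smul_sup, h1 _ inf_le_right,
      h2 _ inf_le_right]
  have hle : ∀ f ≤ c, p • f ≤ c := fun f hf => by
    rw [← hpc]; exact A.smul_mono _ _ _ hf
  have hle' : ∀ f ≤ cᶜ, p • f ≤ cᶜ := fun f hf => by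
    rw [← hpc']; exact A.smul_mono _ _ _ hf
  refine ⟨?_, hqq, ?_⟩
  · refine ext c (fun f hf => ?_) (fun f hf => ?_)
    · rw [mul_smul, mul_smul, hqc _ (hle f hf), hqc f hf]
    · rw [mul_smul, mul_smul, hqc' _ (hle' f hf), hqc' f hf]
  · intro y hyp
    have hp : ∀ f : B, y • p • y⁻¹ • f = p • f := fun f => by
      rw [← mul_smul, ← mul_smul, hyp.eq, mul_assoc, mul_inv_cancel, mul_one]
    have hyc : ∀ f ≤ y • c, (y * q * y⁻¹) • f = p • f := fun f hf => by
      rw [mul_smul, mul_smul, hqc, hp]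
      rw [← A.smul_le_iff y, smul_inv_smul]; exact hf
    have hyc' : ∀ f ≤ (y • c)ᶜ, (y * q * y⁻¹) • f = f := fun f hf => by
      rw [mul_smul, mul_smul, hqc', smul_inv_smul]
      rw [← A.smul_le_iff y, smul_inv_smul, A.smul_compl]; exact hf
    have hpy : p • y • c = y • c := by rw [← mul_smul, ← hyp.eq, mul_smul, hpc]
    have hyle : ∀ f ≤ y • c, p • f ≤ y • c := fun f hf => by
      rw [← hpy]; exact A.smul_mono _ _ _ hf
    have hyle' : ∀ f ≤ (y • c)ᶜ, p • f ≤ (y • c)ᶜ := fun f hf => by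
      rw [← hpy, ← A.smul_compl]; exact A.smul_mono _ _ _ hf
    have hcomm : ∀ f, (f ≤ c ∨ f ≤ cᶜ) → (f ≤ y • c ∨ f ≤ (y • c)ᶜ) →
        q • (y * q * y⁻¹) • f = (y * q * y⁻¹) • q • f := by
      rintro f (h1 | h1) (h2 | h2)
      · rw [hyc f h2, hqc f h1, hqc _ (hle f h1), hyc _ (hyle f h2)]
      · rw [hyc' f h2, hqc f h1, hyc' _ (hyle' f h2)]
      · rw [hyc f h2, hqc' f h1, hqc' _ (hle' f h1), hyc f h2]
      · rw [hyc' f h2, hqc' f h1, hyc' f h2]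
    refine ext c (fun f hf => ?_) (fun f hf => ?_) <;>
    · rw [mul_smul q, mul_smul _ q, ← sup_inf_inf_compl (x := f) (y := y • c)]
      simp only [A.smul_sup]
      rw [hcomm (f ⊓ y • c), hcomm (f ⊓ (y • c)ᶜ)]
      all_goals simp [inf_le_of_left_le hf]

theorem smul_le_of_mem_involutionCentralizer {p x : G} (hpp : p * p = 1)
    (hx : x ∈ involutionCentralizer p) {d : B} (hd : d ≤ A.supp p) : x • d ≤ d ⊔ p • d := by
  set c := d ⊔ p • d with hc
  have hpc : p • c = c := by rw [hc, A.smul_sup, ← mul_smul, hpp, one_smul, sup_comm]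
  have hcp : c ≤ A.supp p := by
    refine sup_le hd ?_
    rw [← A.smul_supp_self p]; exact A.smul_mono _ _ _ hd
  obtain ⟨q, hqq, hqc, hqc'⟩ := A.exists_cut p c hpp hpc
  have hcomm := hx q (A.cut_mem_commutingInvolutions hpc hqq hqc hqc')
  have hsupp : A.supp q = c := by
    apply le_antisymm
    · have := (A.disjoint_supp_iff q cᶜ).2 hqc'
      exact disjoint_compl_right_iff.1 this.symm
    · by_contra hne
      have h1 : c ⊓ (A.supp q)ᶜ ≠ ⊥ := fun h => hne (disjoint_compl_right_iff.1 (disjoint_iff.2 h))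
      obtain ⟨f, hf0, hfe, hfd⟩ := A.exists_disjoint_smul_of_ne_bot h1 (inf_le_left.trans hcp)
      rw [← hqc f (hfe.trans inf_le_left), A.smul_eq_of_disjoint] at hfd
      · exact hf0 (disjoint_self.1 hfd)
      · exact disjoint_compl_left.mono_left (hfe.trans inf_le_right)
  have h2 : x • c = c := by
    rw [← hsupp, ← A.supp_conj, hcomm.eq, mul_inv_cancel_right]
  calc x • d ≤ x • c := A.smul_mono _ _ _ le_sup_left
    _ = c := h2

theorem disjoint_supp_sq {p x : G} (hpp : p * p = 1) (hx : x ∈ involutionCentralizer p) :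
    Disjoint (A.supp p) (A.supp (x * x)) := by
  by_contra hne
  obtain ⟨d₀, hd₀, hd₀p, hd₀d⟩ := A.exists_disjoint_smul hne
  obtain ⟨d, hd, hdd₀, hdp⟩ := A.exists_disjoint_smul_of_ne_bot hd₀ hd₀p
  have hdd : Disjoint ((x * x) • d) d :=
    (hd₀d.mono_left (A.smul_mono _ _ _ hdd₀)).mono_right hdd₀
  have hsp : d ≤ A.supp p := hdd₀.trans hd₀p
  have hxp : Commute x p := hx p (self_mem_commutingInvolutions hpp)
  by_cases h1 : Disjoint (x • d) d
  · have h2 : x • d ≤ p • d :=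
      h1.left_le_of_le_sup_left (A.smul_le_of_mem_involutionCentralizer hpp hx hsp)
    have h3 : (x * x) • d ≤ d := by
      calc (x * x) • d = x • x • d := mul_smul _ _ _
        _ ≤ x • p • d := A.smul_mono _ _ _ h2
        _ = p • x • d := by rw [← mul_smul, hxp.eq, mul_smul]
        _ ≤ p • p • d := A.smul_mono _ _ _ h2
        _ = d := by rw [← mul_smul, hpp, one_smul]
    have h4 : (x * x) • d = ⊥ := disjoint_self.1 (hdd.mono_right h3)
    exact hd ((A.smul_eq_bot_iff _).1 h4)
  · set d' := d ⊓ x⁻¹ • d with hd'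
    have hd'0 : d' ≠ ⊥ := by
      intro h
      apply h1
      rw [← A.smul_disjoint_iff x⁻¹, inv_smul_smul]
      exact disjoint_iff.2 h
    have hxd' : x • d' ≤ d := by
      calc x • d' ≤ x • x⁻¹ • d := A.smul_mono _ _ _ inf_le_right
        _ = d := smul_inv_smul _ _
    have h2 : Disjoint (x • d') (p • d') :=
      (hdp.symm.mono_left hxd').mono_right (A.smul_mono _ _ _ inf_le_left)
    have h3 : x • d' ≤ d' := h2.left_le_of_le_sup_right
      (A.smul_le_of_mem_involutionCentralizer hpp hx (inf_le_left.trans hsp))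
    have h4 : (x * x) • d' ≤ d' := by
      rw [mul_smul]
      exact (A.smul_mono _ _ _ h3).trans h3
    have h5 : Disjoint ((x * x) • d') d' :=
      (hdd.mono_left (A.smul_mono _ _ _ inf_le_left)).mono_right inf_le_left
    exact hd'0 ((A.smul_eq_bot_iff _).1 (disjoint_self.1 (h5.mono_right h4)))

theorem mem_localGroup_iff {p x : G} (hpp : p * p = 1) :
    x ∈ localGroup p ↔ A.supp x ≤ A.supp p := by
  constructor
  · intro hx
    by_contra hne
    have h1 : ¬ Disjoint (A.supp p)ᶜ (A.supp x) := fun h => hne (disjoint_compl_right_iff.1 h.symm)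
    obtain ⟨d, hd0, hdp, hdd⟩ := A.exists_disjoint_smul h1
    obtain ⟨y, hyy, hyd⟩ := A.exists_sq_ne_one hd0
    refine hyy (A.eq_one_of_commute hdd ((A.supp_sq_le y).trans hyd) (hx y fun z hz => ?_))
    exact A.commute_of_disjoint ((disjoint_compl_left.mono_left (hyd.trans hdp)).mono_right
      (A.supp_le_of_mem_commutingInvolutions hz))
  · intro hx y hy
    exact A.commute_of_disjoint ((A.disjoint_supp_sq hpp hy).mono_left hx)

theorem supp_le_compl_iff {g : G} {e : B} :
    A.supp g ≤ eᶜ ↔ ∀ h, A.supp h ≤ e → Commute g h := by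
  constructor
  · intro hg h hh
    exact A.commute_of_disjoint ((disjoint_compl_left.mono_left hg).mono_right hh)
  · intro H
    by_contra hne
    have h1 : ¬ Disjoint e (A.supp g) := fun h => hne (le_compl_iff_disjoint_left.2 h)
    obtain ⟨d, hd0, hde, hdd⟩ := A.exists_disjoint_smul h1
    obtain ⟨y, hy1, -, hyd⟩ := A.exists_involution d hd0
    exact hy1 (A.eq_one_of_commute hdd hyd (H y (hyd.trans hde)))

theorem le_iff_supp {a b : B} : a ≤ b ↔ ∀ g, A.supp g ≤ a → A.supp g ≤ b := by
  refine ⟨fun h g hg => hg.trans h, fun H => ?_⟩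
  by_contra hne
  have h1 : a ⊓ bᶜ ≠ ⊥ := fun h => hne (disjoint_compl_right_iff.1 (disjoint_iff.2 h))
  obtain ⟨y, hy1, -, hyd⟩ := A.exists_involution _ h1
  apply hy1
  rw [← A.supp_eq_bot_iff, ← disjoint_self]
  exact (disjoint_compl_right.mono_left (H y (hyd.trans inf_le_left))).mono_right
    (hyd.trans inf_le_right)

variable {H C : Type*} [Group H] [BooleanAlgebra C] [MulAction H C] (A' : InvolutiveAction H C)

theorem exists_supp_le_iff (f : G ≃* H) (e : B) :
    ∃ e' : C, ∀ g, A'.supp (f g) ≤ e' ↔ A.supp g ≤ e := by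
  refine A.generate (fun e => ∃ e' : C, ∀ g, A'.supp (f g) ≤ e' ↔ A.supp g ≤ e) ?_ ?_ ?_ e
  · intro p hpp
    refine ⟨A'.supp (f p), fun g => ?_⟩
    have hpp' : f p * f p = 1 := by rw [← map_mul, hpp, map_one]
    rw [← A'.mem_localGroup_iff hpp', ← A.mem_localGroup_iff hpp, map_mem_localGroup]
  · rintro a ⟨a', ha⟩
    refine ⟨a'ᶜ, fun g => ?_⟩
    rw [A'.supp_le_compl_iff, A.supp_le_compl_iff, f.surjective.forall]
    simp only [ha, commute_mulEquiv_iff]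
  · rintro a b ⟨a', ha⟩ ⟨b', hb⟩
    refine ⟨a' ⊓ b', fun g => ?_⟩
    rw [le_inf_iff, le_inf_iff, ha, hb]

/-- An isomorphism of groups with involutive actions is induced by an isomorphism of the
Boolean algebras. -/
theorem exists_orderIso (A : InvolutiveAction G B) (A' : InvolutiveAction H C) (f : G ≃* H) :
    ∃ θ : B ≃o C, ∀ g b, θ (g • b) = f g • θ b := by
  choose θ hθ using A.exists_supp_le_iff A' f
  have hle : ∀ a b, θ a ≤ θ b ↔ a ≤ b := by
    intro a b
    rw [A'.le_iff_supp, A.le_iff_supp, f.surjective.forall]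
    simp only [hθ]
  have heq : ∀ (b : B) (c : C), (∀ g, A'.supp (f g) ≤ c ↔ A.supp g ≤ b) → θ b = c := by
    intro b c h
    apply le_antisymm <;> rw [A'.le_iff_supp, f.surjective.forall] <;> simp only [hθ, h] <;>
      exact fun _ => id
  have hsurj : Function.Surjective θ := by
    intro c
    obtain ⟨b, hb⟩ := A'.exists_supp_le_iff A f.symm c
    refine ⟨b, heq b c fun g => ?_⟩
    simpa using (hb (f g)).symm
  let θ' : B ↪o C := OrderEmbedding.ofMapLEIff θ hle
  refine ⟨RelIso.ofSurjective θ' hsurj, fun g b => ?_⟩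
  change θ (g • b) = f g • θ b
  refine heq _ _ fun x => ?_
  have h1 := hθ b (g⁻¹ * x * g⁻¹⁻¹)
  rw [A.supp_conj, map_mul, map_mul, map_inv f g⁻¹, map_inv f g, A'.supp_conj,
    ← A'.smul_le_iff (f g), ← A.smul_le_iff g, smul_inv_smul, smul_inv_smul] at h1
  exact h1

end InvolutiveAction

/-- The idempotents of an inverse monoid with zero. -/
@[ext]
structure Idem (S : Type u) [InverseMonoidWithZero S] : Type u where
  /-- The underlying element. -/
  val : S
  mul_self : val * val = val

namespace Idem

open DistributiveInverseMonoid

section Order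

variable {S : Type u} [InverseMonoidWithZero S]

instance : PartialOrder (Idem S) where
  le e f := e.1 * f.1 = e.1
  le_refl e := e.2
  le_trans a b c hab hbc := by
    rw [← hab, mul_assoc, hbc]
  le_antisymm a b hab hba := Idem.ext <| by
    change a.1 * b.1 = a.1 at hab
    rw [← hab, idem_comm a.2 b.2]
    exact hba

theorem le_iff {e f : Idem S} : e ≤ f ↔ e.1 * f.1 = e.1 := Iff.rfl

theorem le_iff_nle {e f : Idem S} : e ≤ f ↔ nle e.1 f.1 := by
  rw [nle_idem_iff e.2, le_iff, eq_comm]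

/-- The idempotent `s * e * s⁻¹`. -/
def conj (s : S) (e : Idem S) : Idem S := ⟨s * e.1 * s⁻¹, conj_idem s e.2⟩

theorem conj_val (s : S) (e : Idem S) : (conj s e).1 = s * e.1 * s⁻¹ := rfl

theorem conj_mul (s t : S) (e : Idem S) : conj (s * t) e = conj s (conj t e) :=
  Idem.ext (by simp only [conj_val, mul_inv_eq, mul_assoc])

theorem conj_one (e : Idem S) : conj 1 e = e :=
  Idem.ext (by simp only [conj_val, inv_of_idem (one_mul (1 : S)), one_mul, mul_one])

theorem conj_mono (s : S) {e f : Idem S} (h : e ≤ f) : conj s e ≤ conj s f := by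
  rw [le_iff] at h ⊢
  rw [conj_val, conj_val]
  have h1 := mul_idem_eq s e.2
  grind

instance : MulAction Sˣ (Idem S) where
  smul u e := conj u e
  one_smul e := conj_one e
  mul_smul u v e := conj_mul (u : S) (v : S) e

theorem smul_def (u : Sˣ) (e : Idem S) : u • e = conj (u : S) e := rfl

theorem smul_val (u : Sˣ) (e : Idem S) : (u • e).1 = u * e.1 * (u : S)⁻¹ := rfl

end Order

variable {S : Type u}

instance [DistributiveInverseMonoid S] : Lattice (Idem S) where
  sup e f := ⟨DistributiveInverseMonoid.sup e.1 f.1, sup_idem e.2 f.2⟩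
  inf e f := ⟨e.1 * f.1, mul_idem_of_idem e.2 f.2⟩
  le_sup_left e f :=
    le_iff_nle.2 (DistributiveInverseMonoid.le_sup_left _ _ (compat_of_idem e.2 f.2))
  le_sup_right e f :=
    le_iff_nle.2 (DistributiveInverseMonoid.le_sup_right _ _ (compat_of_idem e.2 f.2))
  sup_le e f g he hf := le_iff_nle.2 (DistributiveInverseMonoid.sup_le _ _ _
    (compat_of_idem e.2 f.2) (le_iff_nle.1 he) (le_iff_nle.1 hf))
  inf_le_left e f := by
    have := idem_comm e.2 f.2
    have := e.2
    change e.1 * f.1 * e.1 = e.1 * f.1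
    grind
  inf_le_right e f := by
    change e.1 * f.1 * f.1 = e.1 * f.1
    rw [mul_assoc, f.2]
  le_inf e f g hf hg := by
    change e.1 * (f.1 * g.1) = e.1
    rw [← mul_assoc, le_iff.1 hf, le_iff.1 hg]

theorem inf_val [DistributiveInverseMonoid S] (e f : Idem S) : (e ⊓ f).1 = e.1 * f.1 := rfl

theorem sup_val [DistributiveInverseMonoid S] (e f : Idem S) :
    (e ⊔ f).1 = DistributiveInverseMonoid.sup e.1 f.1 := rfl

instance [DistributiveInverseMonoid S] : DistribLattice (Idem S) :=
  DistribLattice.ofInfSupLe fun a b c => le_of_eq <| Idem.ext <| by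
    simp only [inf_val, sup_val]
    exact DistributiveInverseMonoid.mul_sup _ _ _ (compat_of_idem b.2 c.2)

instance [BooleanInverseMonoid S] : BooleanAlgebra (Idem S) where
  compl e := ⟨BooleanInverseMonoid.compl e.1, BooleanInverseMonoid.compl_idem e.1 e.2⟩
  top := ⟨1, one_mul 1⟩
  bot := ⟨0, zero_idem⟩
  inf_compl_le_bot e := le_of_eq (Idem.ext (BooleanInverseMonoid.mul_compl e.1 e.2))
  top_le_sup_compl e := le_of_eq (Idem.ext (BooleanInverseMonoid.sup_compl e.1 e.2).symm)
  le_top e := mul_one e.1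
  bot_le e := zero_mul_eq e.1

theorem top_val [BooleanInverseMonoid S] : (⊤ : Idem S).1 = 1 := rfl

theorem bot_val [BooleanInverseMonoid S] : (⊥ : Idem S).1 = 0 := rfl

theorem mul_compl_val [BooleanInverseMonoid S] (e : Idem S) : e.1 * (eᶜ).1 = 0 :=
  congrArg Idem.val (inf_compl_eq_bot (a := e))

theorem compl_mul_val [BooleanInverseMonoid S] (e : Idem S) : (eᶜ).1 * e.1 = 0 :=
  congrArg Idem.val (compl_inf_eq_bot (a := e))

theorem ne_bot_iff [BooleanInverseMonoid S] {e : Idem S} : e ≠ ⊥ ↔ e.1 ≠ 0 :=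
  not_congr Idem.ext_iff

theorem disjoint_iff_mul [BooleanInverseMonoid S] {e f : Idem S} :
    Disjoint e f ↔ e.1 * f.1 = 0 :=
  _root_.disjoint_iff.trans Idem.ext_iff

/-- The domain idempotent `s⁻¹ * s`. -/
def dom [InverseMonoidWithZero S] (s : S) : Idem S := ⟨s⁻¹ * s, inv_mul_self_idem s⟩

/-- The range idempotent `s * s⁻¹`. -/
def ran [InverseMonoidWithZero S] (s : S) : Idem S := ⟨s * s⁻¹, mul_inv_self_idem s⟩

theorem conj_sup [DistributiveInverseMonoid S] (s : S) (e f : Idem S) :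
    conj s (e ⊔ f) = conj s e ⊔ conj s f := Idem.ext <| by
  have h := compat_of_idem e.2 f.2
  simp only [conj_val, sup_val]
  rw [DistributiveInverseMonoid.mul_sup _ _ _ h,
    DistributiveInverseMonoid.sup_mul _ _ _ (Compat.mul_left h s)]

theorem conj_mul_val [DistributiveInverseMonoid S] (s : S) (e f : Idem S) :
    conj (s * e.1) f = conj s (e ⊓ f) := Idem.ext <| by
  simp only [conj_val, inf_val, mul_inv_eq, inv_of_idem e.2]
  have := idem_comm e.2 f.2
  have := e.2
  grind

theorem conj_join [DistributiveInverseMonoid S] {a b : S} (h : Compat a b) (e : Idem S) :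
    conj (DistributiveInverseMonoid.sup a b) e = conj a e ⊔ conj b e := by
  have h1 := sup_eq_mul_sup h
  have ha := nle_iff'.1 (DistributiveInverseMonoid.le_sup_left _ _ h)
  have hb := nle_iff'.1 (DistributiveInverseMonoid.le_sup_right _ _ h)
  generalize DistributiveInverseMonoid.sup a b = c at h1 ha hb
  have h2 : conj c e = conj c ((dom a ⊔ dom b) ⊓ e) := by
    rw [← conj_mul_val]; exact congrArg (fun x => conj x e) h1
  have h3 : conj a e = conj c (dom a ⊓ e) := by
    rw [← conj_mul_val]; exact congrArg (fun x => conj x e) ha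
  have h4 : conj b e = conj c (dom b ⊓ e) := by
    rw [← conj_mul_val]; exact congrArg (fun x => conj x e) hb
  rw [h2, h3, h4, inf_sup_right, conj_sup]

theorem conj_inv_join [DistributiveInverseMonoid S] {a b : S} (h : Compat a b) (e : Idem S) :
    conj (DistributiveInverseMonoid.sup a b)⁻¹ e = conj a⁻¹ e ⊔ conj b⁻¹ e := by
  have h1 := sup_eq_sup_mul h
  have ha := nle_iff.1 (DistributiveInverseMonoid.le_sup_left _ _ h)
  have hb := nle_iff.1 (DistributiveInverseMonoid.le_sup_right _ _ h)
  generalize DistributiveInverseMonoid.sup a b = c at h1 ha hb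
  have key : ∀ (x : S) (f : Idem S), x = f.1 * c → conj x⁻¹ e = conj c⁻¹ (f ⊓ e) := by
    rintro _ f rfl
    rw [mul_inv_eq, inv_of_idem f.2, conj_mul_val]
  rw [key c (ran a ⊔ ran b) h1, key a (ran a) ha, key b (ran b) hb, inf_sup_right, conj_sup]

theorem conj_idem_val [DistributiveInverseMonoid S] (e f : Idem S) : conj e.1 f = e ⊓ f :=
    Idem.ext <| by
  rw [conj_val, inv_of_idem e.2, inf_val, mul_assoc, idem_comm f.2 e.2, ← mul_assoc, e.2]

end Idem

open Idem

section ZeroSimplifying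

variable {S : Type u}

theorem ZeroSimplifying.one_mem [DistributiveInverseMonoid S] (h : ZeroSimplifying S) {I : Set S}
    (hI : IsVIdeal I) {a : S} (ha : a ∈ I) (ha0 : a ≠ 0) : (1 : S) ∈ I := by
  rcases h I hI with h1 | h1
  · rw [h1] at ha
    exact absurd ha ha0
  · rw [h1]
    trivial

/-- A predicate stable under multiplication and compatible joins that holds at a nonzero
element holds at `1`. -/
theorem ZeroSimplifying.induction [DistributiveInverseMonoid S] (h : ZeroSimplifying S)
    {P : S → Prop} {a : S} (ha0 : a ≠ 0) (ha : P a)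
    (hl : ∀ x s, P x → P (s * x)) (hr : ∀ x s, P x → P (x * s))
    (hsup : ∀ x y, P x → P y → Compat x y → P (DistributiveInverseMonoid.sup x y)) : P 1 :=
  h.one_mem (I := {x | P x})
    ⟨⟨⟨a, ha⟩, fun x hx s => ⟨hl x s hx, hr x s hx⟩⟩,
      fun x hx y hy hxy => hsup x y hx hy hxy⟩ ha ha0

theorem ZeroSimplifying.exists_ne_zero [DistributiveInverseMonoid S] (h : ZeroSimplifying S)
    {e f : S} (he : e ≠ 0) (hf : f ≠ 0) : ∃ s, e * s * f ≠ 0 := by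
  by_contra! hne
  have h1 := h.induction (P := fun x => ∀ s, e * s * x = 0) hf hne
    (fun x s hx t => by rw [← mul_assoc, mul_assoc e, hx])
    (fun x s hx t => by rw [← mul_assoc, hx, zero_mul_eq])
    (fun x y hx hy hxy s => by
      rw [DistributiveInverseMonoid.mul_sup _ _ _ hxy, hx, hy,
        DistributiveInverseMonoid.sup_zero_eq]) 1
  exact he (by simpa using h1)

theorem eq_of_conj_eq [InverseMonoidWithZero S] (hS : Fundamental S) {s t : S}
    (h : ∀ e, conj s e = conj t e) : s = t := by
  have hc : ∀ e : S, e * e = e → s * e * s⁻¹ = t * e * t⁻¹ := fun e he =>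
    congrArg Idem.val (h ⟨e, he⟩)
  have hr : s * s⁻¹ = t * t⁻¹ := by simpa using hc 1 (one_mul 1)
  have hcomm : (s⁻¹ * t) * (s⁻¹ * t) = s⁻¹ * t := by
    apply hS
    intro e he
    have h1 := mul_idem_eq t he
    have h2 := hc e he
    have h3 : s⁻¹ * (s * e * s⁻¹) = e * s⁻¹ := by
      have h4 := idem_comm he (inv_mul_self_idem s)
      have h5 := inv_mul_inv s
      calc s⁻¹ * (s * e * s⁻¹) = (s⁻¹ * s) * e * s⁻¹ := by simp only [mul_assoc]
        _ = e * (s⁻¹ * s * s⁻¹) := by rw [← h4]; simp only [mul_assoc]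
        _ = e * s⁻¹ := by rw [h5]
    calc s⁻¹ * t * e = s⁻¹ * (t * e) := mul_assoc _ _ _
      _ = s⁻¹ * (s * e * s⁻¹) * t := by rw [h1, h2, mul_assoc s⁻¹]
      _ = e * (s⁻¹ * t) := by rw [h3, mul_assoc]
  have h1 : t = s * (s⁻¹ * t) := by
    rw [← mul_assoc, hr, mul_inv_mul]
  have h2 : s = t * (s⁻¹ * t) := by
    have h3 : t⁻¹ * s = s⁻¹ * t := by
      rw [← inv_of_idem hcomm, mul_inv_eq, inv_inv_eq]
    rw [← h3, ← mul_assoc, ← hr, mul_inv_mul]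
  calc s = t * (s⁻¹ * t) := h2
    _ = s * ((s⁻¹ * t) * (s⁻¹ * t)) := by rw [← mul_assoc s, ← h1]
    _ = t := by rw [hcomm, ← h1]

theorem exists_lt_of_ne_bot [BooleanInverseMonoid S] [Infinite S] (h0 : ZeroSimplifying S)
    (hS : Fundamental S) {e : Idem S} (he : e ≠ ⊥) : ∃ f ≠ ⊥, f < e := by
  by_contra! hne
  have hfin : ∀ f : Idem S, e ⊓ f = ⊥ ∨ e ⊓ f = e := fun f => by
    by_contra! h
    exact hne _ h.1 (lt_of_le_of_ne inf_le_left h.2)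
  have h1 := h0.induction (P := fun x => (Set.range fun f : Idem S => x * f.1).Finite)
    (ne_bot_iff.1 he)
    ((Set.toFinite {(⊥ : Idem S).1, e.1}).subset (by
      rintro _ ⟨f, rfl⟩
      rcases hfin f with h | h
      · exact Or.inl (congrArg Idem.val h)
      · exact Or.inr (congrArg Idem.val h)))
    (fun x s hx => (hx.image fun y => s * y).subset (by
      rintro _ ⟨f, rfl⟩
      exact ⟨_, ⟨f, rfl⟩, (mul_assoc _ _ _).symm⟩))
    (fun x s hx => (hx.image fun y => y * s).subset (by
      rintro _ ⟨f, rfl⟩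
      refine ⟨_, ⟨conj s f, rfl⟩, ?_⟩
      simp only [conj_val, mul_assoc x, ← mul_idem_eq s f.2]))
    (fun x y hx hy hxy => (Set.Finite.image2 DistributiveInverseMonoid.sup hx hy).subset (by
      rintro _ ⟨f, rfl⟩
      exact ⟨_, ⟨f, rfl⟩, _, ⟨f, rfl⟩, (DistributiveInverseMonoid.sup_mul _ _ _ hxy).symm⟩))
  have h2 : Finite (Idem S) := by
    have h3 : (Set.range fun f : Idem S => f.1).Finite := by simpa only [one_mul] using h1
    exact (Set.finite_range_iff fun _ _ => Idem.ext).1 h3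
  have h4 : Function.Injective (conj : S → Idem S → Idem S) := fun s t hst =>
    eq_of_conj_eq hS (congrFun hst)
  exact not_finite_iff_infinite.2 ‹Infinite S› (Finite.of_injective _ h4)

end ZeroSimplifying

section UnitAction

variable {S : Type u}

theorem unit_mul_inv [InverseMonoidWithZero S] (u : Sˣ) : (u : S) * (u : S)⁻¹ = 1 := by
  rw [← val_inv_unit, Units.mul_inv]

theorem unit_inv_mul [InverseMonoidWithZero S] (u : Sˣ) : (u : S)⁻¹ * (u : S) = 1 := by
  rw [← val_inv_unit, Units.inv_mul]

theorem conj_bot [BooleanInverseMonoid S] (s : S) : conj s (⊥ : Idem S) = ⊥ :=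
  Idem.ext (by rw [conj_val, bot_val, mul_zero_eq, zero_mul_eq])

/-- The largest idempotent fixed by `s`, that is, `s ∧ 1`. -/
def fixedIdem [BooleanInverseMeetMonoid S] (s : S) : Idem S :=
  ⟨phi s, nle_one_iff.1 (BooleanInverseMeetMonoid.inf_le_right s 1)⟩

theorem le_fixedIdem_iff [BooleanInverseMeetMonoid S] {s : S} {e : Idem S} :
    e ≤ fixedIdem s ↔ e.1 * s = e.1 := by
  have h1 : nle (phi s) s := BooleanInverseMeetMonoid.inf_le_left s 1
  constructor
  · intro h
    have h2 : phi s = phi s * s := (nle_idem_iff (fixedIdem s).2).1 h1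
    have h3 : e.1 * phi s = e.1 := le_iff.1 h
    rw [← h3, mul_assoc, ← h2]
  · intro h
    rw [le_iff_nle]
    exact BooleanInverseMeetMonoid.le_inf _ _ _ ⟨e.1, e.2, h.symm⟩ (nle_one_iff.2 e.2)

theorem le_fixedIdem_unit_iff [BooleanInverseMeetMonoid S] (hS : Fundamental S) {u : Sˣ}
    {e : Idem S} : e ≤ fixedIdem (u : S) ↔ ∀ f ≤ e, u • f = f := by
  constructor
  · intro h f hf
    have h1 : f.1 * u = f.1 := le_fixedIdem_iff.1 (hf.trans h)
    have h2 : (u : S)⁻¹ * f.1 = f.1 := by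
      have h3 := congrArg (fun x => x⁻¹) h1
      simpa only [mul_inv_eq, inv_of_idem f.2] using h3
    have h4 : (u : S) * f.1 = f.1 := by
      conv_lhs => rw [← h2]
      rw [← mul_assoc, unit_mul_inv, one_mul]
    have h5 : f.1 * (u : S)⁻¹ = f.1 := by
      conv_lhs => rw [← h1]
      rw [mul_assoc, unit_mul_inv, mul_one]
    exact Idem.ext (by rw [smul_val, h4, h5])
  · intro h
    rw [le_fixedIdem_iff]
    have h1 : ∀ f ≤ e, (u : S) * f.1 = f.1 * u := fun f hf => by
      have h2 : (u : S) * f.1 * (u : S)⁻¹ = f.1 := congrArg Idem.val (h f hf)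
      calc (u : S) * f.1 = (u : S) * f.1 * ((u : S)⁻¹ * u) := by rw [unit_inv_mul, mul_one]
        _ = f.1 * u := by rw [← mul_assoc, h2]
    have h3 : (e.1 * u) * (e.1 * u) = e.1 * u := by
      apply hS
      intro f hf
      have h4 := h1 (e ⊓ ⟨f, hf⟩) inf_le_left
      rw [inf_val] at h4
      calc e.1 * u * f = u * (e.1 * f) := by rw [← h1 e le_rfl, mul_assoc]
        _ = f * (e.1 * u) := by rw [h4, idem_comm e.2 hf, mul_assoc]
    calc e.1 * u = (e.1 * u) * (e.1 * u)⁻¹ := by rw [inv_of_idem h3, h3]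
      _ = e.1 * ((u : S) * (u : S)⁻¹) * e.1 := by
        rw [mul_inv_eq, inv_of_idem e.2]; simp only [mul_assoc]
      _ = e.1 := by rw [unit_mul_inv, mul_one, e.2]

theorem dom_le_of_mul_eq [InverseMonoidWithZero S] {a : S} {e : Idem S} (h : a * e.1 = a) :
    dom a ≤ e := by
  rw [le_iff]
  change a⁻¹ * a * e.1 = a⁻¹ * a
  rw [mul_assoc, h]

theorem ran_le_of_mul_eq [InverseMonoidWithZero S] {a : S} {e : Idem S} (h : e.1 * a = a) :
    ran a ≤ e := by
  rw [le_iff, idem_comm (ran a).2 e.2]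
  change e.1 * (a * a⁻¹) = a * a⁻¹
  rw [← mul_assoc, h]

theorem mul_dom [InverseMonoidWithZero S] (a : S) : a * (dom a).1 = a := by
  change a * (a⁻¹ * a) = a
  rw [← mul_assoc, mul_inv_mul]

theorem ran_mul [InverseMonoidWithZero S] (a : S) : (ran a).1 * a = a := mul_inv_mul a

/-- An element of square zero lies beneath an involution supported on its domain and range. -/
theorem exists_involution_of_sq_zero [BooleanInverseMonoid S] {a : S} (ha : a * a = 0) :
    ∃ u : Sˣ, u * u = 1 ∧ a = u * (dom a).1 ∧ ∀ f ≤ (dom a ⊔ ran a)ᶜ, u • f = f := by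
  set c := (dom a ⊔ ran a)ᶜ with hc
  have hai : a⁻¹ * a⁻¹ = 0 := by rw [← mul_inv_eq, ha, inv_zero_eq]
  have hcompat : Compat a a⁻¹ := compat_of_orth ⟨by rw [inv_inv_eq, ha], hai⟩
  set w := DistributiveInverseMonoid.sup a a⁻¹ with hw
  have hww : w * w = (dom a ⊔ ran a).1 := by
    rw [hw, DistributiveInverseMonoid.mul_sup _ _ _ hcompat,
      DistributiveInverseMonoid.sup_mul _ _ _ hcompat,
      DistributiveInverseMonoid.sup_mul _ _ _ hcompat, ha, hai,
      DistributiveInverseMonoid.sup_zero_eq, DistributiveInverseMonoid.zero_sup_eq]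
    rfl
  have hdc : (dom a).1 * c.1 = 0 :=
    disjoint_iff_mul.1 (disjoint_compl_right.mono_left le_sup_left)
  have hrc : (ran a).1 * c.1 = 0 :=
    disjoint_iff_mul.1 (disjoint_compl_right.mono_left le_sup_right)
  have hdr : (ran a).1 * (dom a).1 = 0 := by
    rw [idem_comm (ran a).2 (dom a).2]
    change a⁻¹ * a * (a * a⁻¹) = 0
    rw [mul_assoc, ← mul_assoc a, ha, zero_mul_eq, mul_zero_eq]
  have hac : a * c.1 = 0 := by rw [← mul_dom a, mul_assoc, hdc, mul_zero_eq]
  have hir : a⁻¹ * (ran a).1 = a⁻¹ := by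
    change a⁻¹ * (a * a⁻¹) = a⁻¹
    rw [← mul_assoc, inv_mul_inv]
  have hid : (dom a).1 * a⁻¹ = a⁻¹ := inv_mul_inv a
  have haic : a⁻¹ * c.1 = 0 := by rw [← hir, mul_assoc, hrc, mul_zero_eq]
  have hca : c.1 * a = 0 := by
    rw [← ran_mul a, ← mul_assoc, idem_comm c.2 (ran a).2, hrc, zero_mul_eq]
  have hcai : c.1 * a⁻¹ = 0 := by
    rw [← hid, ← mul_assoc, idem_comm c.2 (dom a).2, hdc, zero_mul_eq]
  have hwc : w * c.1 = 0 := by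
    rw [hw, DistributiveInverseMonoid.sup_mul _ _ _ hcompat, hac, haic,
      DistributiveInverseMonoid.sup_zero_eq]
  have hcw : c.1 * w = 0 := by
    rw [hw, DistributiveInverseMonoid.mul_sup _ _ _ hcompat, hca, hcai,
      DistributiveInverseMonoid.sup_zero_eq]
  have hwi : w⁻¹ * c.1 = 0 := by
    have := congrArg (fun x => x⁻¹) hcw
    simpa only [mul_inv_eq, inv_of_idem c.2, inv_zero_eq] using this
  have hcompat' : Compat w c.1 := compat_of_orth ⟨by rw [inv_of_idem c.2, hwc], hwi⟩
  set v := DistributiveInverseMonoid.sup w c.1 with hv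
  have hvv : v * v = 1 := by
    rw [hv, DistributiveInverseMonoid.sup_mul_self hcompat' hwc hcw, hww, c.2]
    exact BooleanInverseMonoid.sup_compl _ (dom a ⊔ ran a).2
  have hvc : v * c.1 = c.1 := by
    rw [hv, DistributiveInverseMonoid.sup_mul _ _ _ hcompat', hwc, c.2,
      DistributiveInverseMonoid.zero_sup_eq]
  refine ⟨unitOfSq v hvv, Units.ext hvv, ?_, fun f hf => ?_⟩
  · change a = v * (dom a).1
    have h1 : a⁻¹ * (dom a).1 = 0 := by rw [← hir, mul_assoc, hdr, mul_zero_eq]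
    rw [hv, DistributiveInverseMonoid.sup_mul _ _ _ hcompat', idem_comm c.2 (dom a).2, hdc,
      DistributiveInverseMonoid.sup_zero_eq, hw, DistributiveInverseMonoid.sup_mul _ _ _ hcompat,
      mul_dom, h1, DistributiveInverseMonoid.sup_zero_eq]
  · have h1 : v * f.1 = f.1 := by
      have h2 : c.1 * f.1 = f.1 := by rw [idem_comm c.2 f.2]; exact le_iff.1 hf
      rw [← h2, ← mul_assoc, hvc]
    have h3 : f.1 * v⁻¹ = f.1 := by
      have := congrArg (fun x => x⁻¹) h1
      simpa only [mul_inv_eq, inv_of_idem f.2] using this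
    exact Idem.ext (by rw [smul_val]; change v * f.1 * v⁻¹ = f.1; rw [h1, h3])

theorem exists_cut_involution [BooleanInverseMonoid S] (p : Sˣ) (c : Idem S) (hp : p * p = 1)
    (hc : p • c = c) :
    ∃ q : Sˣ, q * q = 1 ∧ (∀ f ≤ c, q • f = p • f) ∧ ∀ f ≤ cᶜ, q • f = f := by
  have hpp : (p : S) * p = 1 := congrArg Units.val hp
  have hpi : (p : S)⁻¹ = p := inv_eq_self_of_sq_one hpp
  have hpc : (p : S) * c.1 = c.1 * p := by
    have h1 : (p : S) * c.1 * (p : S)⁻¹ = c.1 := congrArg Idem.val hc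
    calc (p : S) * c.1 = (p : S) * c.1 * (p : S)⁻¹ * p := by
          rw [mul_assoc _ _ (p : S), unit_inv_mul, mul_one]
      _ = c.1 * p := by rw [h1]
  have h1 : (p : S) * c.1 * (cᶜ).1 = 0 := by rw [mul_assoc, mul_compl_val, mul_zero_eq]
  have h2 : (cᶜ).1 * ((p : S) * c.1) = 0 := by
    rw [hpc, ← mul_assoc, compl_mul_val, zero_mul_eq]
  have h3 : ((p : S) * c.1)⁻¹ * (cᶜ).1 = 0 := by
    rw [mul_inv_eq, inv_of_idem c.2, hpi, ← hpc, h1]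
  have hcompat : Compat ((p : S) * c.1) (cᶜ).1 :=
    compat_of_orth ⟨by rw [inv_of_idem (cᶜ).2, h1], h3⟩
  have h4 : (p : S) * c.1 * ((p : S) * c.1) = c.1 := by
    calc (p : S) * c.1 * ((p : S) * c.1) = c.1 * p * (p * c.1) :=
          congrArg (· * ((p : S) * c.1)) hpc
      _ = c.1 * (p * p) * c.1 := by simp only [mul_assoc]
      _ = c.1 := by rw [hpp, mul_one, c.2]
  set v := DistributiveInverseMonoid.sup ((p : S) * c.1) (cᶜ).1 with hv
  have hvv : v * v = 1 := by
    rw [hv, DistributiveInverseMonoid.sup_mul_self hcompat h1 h2, h4, (cᶜ).2]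
    exact BooleanInverseMonoid.sup_compl _ c.2
  have hconj : ∀ f, unitOfSq v hvv • f = p • (c ⊓ f) ⊔ (cᶜ ⊓ f) := fun f => by
    change conj v f = conj (p : S) (c ⊓ f) ⊔ (cᶜ ⊓ f)
    rw [hv, conj_join hcompat, conj_mul_val, conj_idem_val]
  refine ⟨unitOfSq v hvv, Units.ext hvv, fun f hf => ?_, fun f hf => ?_⟩
  · rw [hconj, inf_eq_right.2 hf, (disjoint_compl_left.mono_right hf).eq_bot, sup_bot_eq]
  · rw [hconj, inf_eq_right.2 hf, (disjoint_compl_right.mono_right hf).eq_bot, smul_def, conj_bot,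
      bot_sup_eq]

/-- The support of a unit: the complement of its fixed idempotent. -/
def unitSupp [BooleanInverseMeetMonoid S] (u : Sˣ) : Idem S := (fixedIdem (u : S))ᶜ

theorem disjoint_unitSupp_iff [BooleanInverseMeetMonoid S] (hS : Fundamental S) (u : Sˣ)
    (e : Idem S) : Disjoint e (unitSupp u) ↔ ∀ f ≤ e, u • f = f := by
  rw [unitSupp, disjoint_compl_right_iff, le_fixedIdem_unit_iff hS]

theorem mul_mul_sq_zero [BooleanInverseMonoid S] {f g : Idem S} (h : Disjoint f g) (s : S) :
    (f.1 * s * g.1) * (f.1 * s * g.1) = 0 := by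
  have h1 : g.1 * f.1 = 0 := disjoint_iff_mul.1 h.symm
  calc (f.1 * s * g.1) * (f.1 * s * g.1) = f.1 * s * (g.1 * f.1) * s * g.1 := by
        simp only [mul_assoc]
    _ = 0 := by simp only [h1, mul_zero_eq, zero_mul_eq]

theorem exists_involution_of_disjoint [BooleanInverseMeetMonoid S] (hS : Fundamental S)
    {f g : Idem S} (h : Disjoint f g) (s : S) :
    ∃ u : Sˣ, u * u = 1 ∧ unitSupp u ≤ f ⊔ g ∧
      f.1 * s * g.1 = u * (dom (f.1 * s * g.1)).1 ∧ dom (f.1 * s * g.1) ≤ unitSupp u := by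
  set a := f.1 * s * g.1 with ha
  have haa : a * a = 0 := mul_mul_sq_zero h s
  obtain ⟨u, huu, hua, hu⟩ := exists_involution_of_sq_zero haa
  have hd : dom a ≤ g := dom_le_of_mul_eq (by rw [ha, mul_assoc, g.2])
  have hr : ran a ≤ f := ran_le_of_mul_eq (by rw [ha, ← mul_assoc, ← mul_assoc, f.2])
  refine ⟨u, huu, ?_, hua, ?_⟩
  · have h1 := ((disjoint_unitSupp_iff hS u _).2 hu).symm
    exact (disjoint_compl_right_iff.1 h1).trans (sup_le (hd.trans le_sup_right)
      (hr.trans le_sup_left))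
  · set m := dom a ⊓ (unitSupp u)ᶜ with hm
    have h1 : u • m = m := (disjoint_unitSupp_iff hS u m).1
      (disjoint_compl_left.mono_left inf_le_right) m le_rfl
    have h2 : conj a ⊤ = ran a := Idem.ext (by rw [conj_val, top_val, mul_one]; rfl)
    have h3 : m ≤ ran a := by
      calc m = conj (u : S) (dom a ⊓ m) := by
            rw [inf_eq_right.2 (inf_le_left : m ≤ dom a)]; exact h1.symm
        _ = conj a m := by rw [← conj_mul_val, ← hua]
        _ ≤ conj a ⊤ := conj_mono _ le_top
        _ = ran a := h2
    have h4 : m = ⊥ := disjoint_self.1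
      ((h.mono_left (h3.trans hr)).mono_right (inf_le_left.trans hd))
    exact disjoint_compl_right_iff.1 (disjoint_iff.2 h4)

theorem exists_split [BooleanInverseMonoid S] [Infinite S] (h0 : ZeroSimplifying S)
    (hS : Fundamental S) {e : Idem S} (he : e ≠ ⊥) :
    ∃ f g : Idem S, f ≠ ⊥ ∧ g ≠ ⊥ ∧ Disjoint f g ∧ f ⊔ g = e := by
  obtain ⟨f, hf, hfe⟩ := exists_lt_of_ne_bot h0 hS he
  exact ⟨f, e \ f, hf, fun h => hfe.not_ge (sdiff_eq_bot_iff.1 h), disjoint_sdiff_self_right,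
    sup_sdiff_cancel_right hfe.le⟩

theorem exists_generated_between [BooleanInverseMeetMonoid S] (h0 : ZeroSimplifying S)
    (hS : Fundamental S) {P : Idem S → Prop} (hP : ∀ p : Sˣ, p * p = 1 → P (unitSupp p))
    (hsup : ∀ a b, P a → P b → P (a ⊔ b)) {f g : Idem S} (hf : f ≠ ⊥) (hfg : Disjoint f g) :
    ∃ k, P k ∧ g ≤ k ∧ k ≤ f ⊔ g := by
  have h1 := h0.induction
    (P := fun x => ∀ s, ∃ k : Idem S, P k ∧ k ≤ f ⊔ g ∧ x * s * g.1 * k.1 = x * s * g.1)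
    (ne_bot_iff.1 hf)
    (fun s => by
      obtain ⟨u, huu, hule, -, hu⟩ := exists_involution_of_disjoint hS hfg s
      refine ⟨unitSupp u, hP u huu, hule, ?_⟩
      have h2 := mul_dom (f.1 * s * g.1)
      rw [← h2, mul_assoc, le_iff.1 hu])
    (fun x t hx s => by
      obtain ⟨k, hk, hke, hxk⟩ := hx s
      refine ⟨k, hk, hke, ?_⟩
      simp only [mul_assoc] at hxk ⊢
      rw [hxk])
    (fun x t hx s => by
      obtain ⟨k, hk, hke, hxk⟩ := hx (t * s)
      refine ⟨k, hk, hke, ?_⟩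
      simpa only [mul_assoc] using hxk)
    (fun x y hx hy hxy s => by
      obtain ⟨k, hk, hke, hxk⟩ := hx s
      obtain ⟨l, hl, hle, hyl⟩ := hy s
      refine ⟨k ⊔ l, hsup k l hk hl, sup_le hke hle, ?_⟩
      rw [DistributiveInverseMonoid.sup_mul _ _ _ hxy,
        DistributiveInverseMonoid.sup_mul _ _ _ (Compat.mul_right hxy s),
        DistributiveInverseMonoid.sup_mul _ _ _ (Compat.mul_right (Compat.mul_right hxy s) g.1)]
      have hk' : k.1 * (k ⊔ l).1 = k.1 := le_iff.1 le_sup_left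
      have hl' : l.1 * (k ⊔ l).1 = l.1 := le_iff.1 le_sup_right
      rw [← hxk, ← hyl, mul_assoc _ k.1, hk', mul_assoc _ l.1, hl'])
    1
  obtain ⟨k, hk, hke, h⟩ := h1
  refine ⟨k, hk, ?_, hke⟩
  rw [le_iff]
  simpa only [one_mul] using h

/-- The units of a Boolean inverse ∧-monoid act involutively on its idempotents. -/
def unitsInvolutiveAction [BooleanInverseMeetMonoid S] [Infinite S] (h0 : ZeroSimplifying S)
    (hS : Fundamental S) : InvolutiveAction Sˣ (Idem S) where
  smul_mono g a b h := conj_mono (g : S) h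
  supp := unitSupp
  disjoint_supp_iff := disjoint_unitSupp_iff hS
  eq_one_of_supp g hg := by
    have h1 : (⊤ : Idem S) ≤ fixedIdem (g : S) := (compl_eq_bot.1 hg).ge
    exact Units.ext (by simpa only [top_val, one_mul, Units.val_one] using le_fixedIdem_iff.1 h1)
  exists_involution e he := by
    obtain ⟨f, g, hf, hg, hfg, rfl⟩ := exists_split h0 hS he
    obtain ⟨s, hs⟩ := h0.exists_ne_zero (ne_bot_iff.1 hf) (ne_bot_iff.1 hg)
    obtain ⟨u, huu, hle, hua, -⟩ := exists_involution_of_disjoint hS hfg s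
    refine ⟨u, ?_, huu, hle⟩
    rintro rfl
    apply hs
    have h1 := mul_mul_sq_zero hfg s
    rw [Units.val_one, one_mul] at hua
    rw [hua] at h1 ⊢
    rwa [(dom _).2] at h1
  exists_cut := exists_cut_involution
  generate P hP hcompl hinf e := by
    have hsup : ∀ a b, P a → P b → P (a ⊔ b) := fun a b ha hb => by
      have h1 := hcompl _ (hinf _ _ (hcompl a ha) (hcompl b hb))
      rwa [compl_inf, compl_compl, compl_compl] at h1
    by_cases he : e = ⊥
    · have h1 : unitSupp (1 : Sˣ) = ⊥ :=
        top_disjoint.1 ((disjoint_unitSupp_iff hS 1 ⊤).2 fun f _ => one_smul _ f)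
      rw [he, ← h1]
      exact hP 1 (one_mul 1)
    · obtain ⟨f, g, hf, hg, hfg, rfl⟩ := exists_split h0 hS he
      obtain ⟨k, hk, hgk, hkle⟩ := exists_generated_between h0 hS hP hsup hf hfg
      obtain ⟨l, hl, hfl, hlle⟩ := exists_generated_between h0 hS hP hsup hg hfg.symm
      rw [sup_comm g f] at hlle
      have h1 : l ⊔ k = f ⊔ g := le_antisymm (sup_le hlle hkle) (sup_le_sup hfl hgk)
      rw [← h1]
      exact hsup l k hl hk

/-- Every element is obtained from units and idempotents by products and compatible joins. -/
theorem unit_idem_induction [BooleanInverseMonoid S] [Infinite S] (h0 : ZeroSimplifying S)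
    (hS : Fundamental S) {Q : S → Prop} (hunit : ∀ u : Sˣ, Q u) (hidem : ∀ e : Idem S, Q e.1)
    (hmul : ∀ s t, Q s → Q t → Q (s * t))
    (hsup : ∀ s t, Q s → Q t → Compat s t → Q (DistributiveInverseMonoid.sup s t)) (s : S) :
    Q s := by
  have hsq : ∀ a : S, a * a = 0 → Q a := fun a ha => by
    obtain ⟨u, -, hua, -⟩ := exists_involution_of_sq_zero ha
    rw [hua]
    exact hmul _ _ (hunit u) (hidem _)
  have hoff : ∀ (e f : Idem S) (s : S), Disjoint e f → Q (e.1 * s * f.1) := fun e f s h =>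
    hsq _ (mul_mul_sq_zero h s)
  have hdiag : ∀ (e : Idem S) (s : S), eᶜ ≠ ⊥ → Q (e.1 * s * e.1) := fun e s he => by
    have h1 := h0.induction (P := fun x => ∀ s t, Q (e.1 * s * x * t * e.1)) (ne_bot_iff.1 he)
      (fun s t => by
        have h2 := hmul _ _ (hoff e eᶜ s disjoint_compl_right) (hoff eᶜ e t disjoint_compl_left)
        have h3 : e.1 * s * (eᶜ).1 * ((eᶜ).1 * t * e.1) = e.1 * s * (eᶜ).1 * t * e.1 := by
          simp only [← mul_assoc]
          rw [mul_assoc _ (eᶜ).1 (eᶜ).1, (eᶜ).2]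
        rwa [h3] at h2)
      (fun x y hx s t => by simpa only [mul_assoc] using hx (s * y) t)
      (fun x y hx s t => by simpa only [mul_assoc] using hx s (y * t))
      (fun x y hx hy hxy s t => by
        rw [DistributiveInverseMonoid.mul_sup _ _ _ hxy,
          DistributiveInverseMonoid.sup_mul _ _ _ (Compat.mul_left hxy _),
          DistributiveInverseMonoid.sup_mul _ _ _ (Compat.mul_right (Compat.mul_left hxy _) _)]
        exact hsup _ _ (hx s t) (hy s t)
          (Compat.mul_right (Compat.mul_right (Compat.mul_left hxy _) _) _)) s 1
    simpa only [mul_one] using h1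
  have hleft : ∀ (e : Idem S) (s : S), Q (e.1 * s) → Q ((eᶜ).1 * s) → Q s := fun e s h h' => by
    have hc := compat_of_idem e.2 (eᶜ).2
    have h1 := hsup _ _ h h' (Compat.mul_right hc s)
    have h2 : DistributiveInverseMonoid.sup e.1 (eᶜ).1 = 1 := BooleanInverseMonoid.sup_compl _ e.2
    rwa [← DistributiveInverseMonoid.sup_mul _ _ _ hc, h2, one_mul] at h1
  have hright : ∀ (e : Idem S) (s : S), Q (s * e.1) → Q (s * (eᶜ).1) → Q s := fun e s h h' => by
    have hc := compat_of_idem e.2 (eᶜ).2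
    have h1 := hsup _ _ h h' (Compat.mul_left hc s)
    have h2 : DistributiveInverseMonoid.sup e.1 (eᶜ).1 = 1 := BooleanInverseMonoid.sup_compl _ e.2
    rwa [← DistributiveInverseMonoid.mul_sup _ _ _ hc, h2, mul_one] at h1
  have htop : (⊤ : Idem S) ≠ ⊥ := by
    rw [ne_bot_iff, top_val]
    intro h
    obtain ⟨x, hx⟩ := exists_ne (0 : S)
    exact hx (by rw [← one_mul x, h, zero_mul_eq])
  obtain ⟨e, he, het⟩ := exists_lt_of_ne_bot h0 hS htop
  have he' : eᶜ ≠ ⊥ := fun h => het.ne (compl_eq_bot.1 h)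
  have he'' : eᶜᶜ ≠ ⊥ := by rwa [compl_compl]
  refine hleft e s (hright e _ (hdiag e s he') (hoff e eᶜ s disjoint_compl_right))
    (hright e _ (hoff eᶜ e s disjoint_compl_left) (hdiag eᶜ s he''))

end UnitAction

section Correspondence

variable {S T : Type u}

/-- Elements correspond along `θ` if `θ` intertwines their conjugation maps. -/
def Corresponds [InverseMonoidWithZero S] [InverseMonoidWithZero T] (θ : Idem S ≃o Idem T)
    (s : S) (t : T) : Prop :=
  (∀ e, θ (conj s e) = conj t (θ e)) ∧ ∀ e, θ (conj s⁻¹ e) = conj t⁻¹ (θ e)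

theorem Corresponds.symm [InverseMonoidWithZero S] [InverseMonoidWithZero T]
    {θ : Idem S ≃o Idem T} {s : S} {t : T} (h : Corresponds θ s t) : Corresponds θ.symm t s :=
  ⟨fun e => by rw [θ.symm_apply_eq, h.1, θ.apply_symm_apply],
    fun e => by rw [θ.symm_apply_eq, h.2, θ.apply_symm_apply]⟩

theorem Corresponds.inv [InverseMonoidWithZero S] [InverseMonoidWithZero T]
    {θ : Idem S ≃o Idem T} {s : S} {t : T} (h : Corresponds θ s t) : Corresponds θ s⁻¹ t⁻¹ :=
  ⟨h.2, fun e => by rw [inv_inv_eq, inv_inv_eq, h.1]⟩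

theorem Corresponds.mul [InverseMonoidWithZero S] [InverseMonoidWithZero T]
    {θ : Idem S ≃o Idem T} {s s' : S} {t t' : T} (h : Corresponds θ s t)
    (h' : Corresponds θ s' t') : Corresponds θ (s * s') (t * t') :=
  ⟨fun e => by rw [Idem.conj_mul, Idem.conj_mul, h.1, h'.1],
    fun e => by rw [mul_inv_eq, mul_inv_eq, Idem.conj_mul, Idem.conj_mul, h'.2, h.2]⟩

theorem Corresponds.unique [InverseMonoidWithZero S] [InverseMonoidWithZero T]
    (hT : Fundamental T) {θ : Idem S ≃o Idem T} {s : S} {t t' : T} (h : Corresponds θ s t)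
    (h' : Corresponds θ s t') : t = t' :=
  eq_of_conj_eq hT fun e => by
    obtain ⟨e, rfl⟩ := θ.surjective e
    rw [← h.1, ← h'.1]

theorem Corresponds.idem [DistributiveInverseMonoid S] [DistributiveInverseMonoid T]
    (θ : Idem S ≃o Idem T) (e : Idem S) : Corresponds θ e.1 (θ e).1 := by
  have h1 : ∀ f, θ (conj e.1 f) = conj (θ e).1 (θ f) := fun f => by
    rw [conj_idem_val, conj_idem_val, map_inf]
  exact ⟨h1, by rwa [inv_of_idem e.2, inv_of_idem (θ e).2]⟩

theorem Corresponds.compat [DistributiveInverseMonoid S] [DistributiveInverseMonoid T]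
    (hT : Fundamental T) {θ : Idem S ≃o Idem T} {s s' : S} {t t' : T} (h : Corresponds θ s t)
    (h' : Corresponds θ s' t') (hc : Compat s s') : Compat t t' := by
  have key : ∀ {x : S} {y : T}, x * x = x → Corresponds θ x y → y * y = y := fun {x y} hx hxy => by
    rw [hxy.unique hT (Corresponds.idem θ ⟨x, hx⟩), (θ ⟨x, hx⟩).2]
  exact ⟨key hc.1 (h.mul h'.inv), key hc.2 (h.inv.mul h')⟩

theorem Corresponds.join [DistributiveInverseMonoid S] [DistributiveInverseMonoid T]
    {θ : Idem S ≃o Idem T} {s s' : S} {t t' : T} (h : Corresponds θ s t)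
    (h' : Corresponds θ s' t') (hs : Compat s s') (ht : Compat t t') :
    Corresponds θ (DistributiveInverseMonoid.sup s s') (DistributiveInverseMonoid.sup t t') :=
  ⟨fun e => by rw [conj_join hs, conj_join ht, map_sup, h.1, h'.1],
    fun e => by rw [conj_inv_join hs, conj_inv_join ht, map_sup, h.2, h'.2]⟩

theorem exists_corresponds [BooleanInverseMonoid S] [BooleanInverseMonoid T] [Infinite S]
    (h0 : ZeroSimplifying S) (hS : Fundamental S) (hT : Fundamental T) (f : Sˣ ≃* Tˣ)
    {θ : Idem S ≃o Idem T} (hθ : ∀ (g : Sˣ) e, θ (g • e) = f g • θ e) (s : S) :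
    ∃ t, Corresponds θ s t := by
  refine unit_idem_induction h0 hS (Q := fun s => ∃ t, Corresponds θ s t) ?_ ?_ ?_ ?_ s
  · intro u
    refine ⟨f u, hθ u, fun e => ?_⟩
    rw [← val_inv_unit, ← val_inv_unit, ← map_inv]
    exact hθ u⁻¹ e
  · exact fun e => ⟨_, Corresponds.idem θ e⟩
  · rintro s s' ⟨t, ht⟩ ⟨t', ht'⟩
    exact ⟨_, ht.mul ht'⟩
  · rintro s s' ⟨t, ht⟩ ⟨t', ht'⟩ hc
    exact ⟨_, ht.join ht' hc (ht.compat hT ht' hc)⟩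

end Correspondence

/-- Spatial Realization Theorem. Two countably infinite
Boolean inverse ∧-monoids which are 0-simplifying and fundamental are
isomorphic iff their groups of units are isomorphic. -/
theorem statement0 (S T : Type u) [BooleanInverseMeetMonoid S] [BooleanInverseMeetMonoid T]
    [Countable S] [Infinite S] [Countable T] [Infinite T]
    (hS0 : ZeroSimplifying S) (hSf : Fundamental S)
    (hT0 : ZeroSimplifying T) (hTf : Fundamental T) :
    Nonempty (S ≃* T) ↔ Nonempty (Sˣ ≃* Tˣ) := by
  refine ⟨fun ⟨f⟩ => ⟨Units.mapEquiv f⟩, fun ⟨f⟩ => ?_⟩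
  obtain ⟨θ, hθ⟩ := (unitsInvolutiveAction hS0 hSf).exists_orderIso
    (unitsInvolutiveAction hT0 hTf) f
  have hθ' : ∀ (g : Tˣ) e, θ.symm (g • e) = f.symm g • θ.symm e := fun g e => by
    rw [θ.symm_apply_eq, hθ, f.apply_symm_apply, θ.apply_symm_apply]
  choose F hF using exists_corresponds hS0 hSf hTf f hθ
  refine ⟨MulEquiv.ofBijective (MulHom.mk F fun s s' => ?_) ⟨fun s s' h => ?_, fun t => ?_⟩⟩
  · exact (hF (s * s')).unique hTf ((hF s).mul (hF s'))
  · have h1 : Corresponds θ s' (F s) := by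
      have h2 : F s = F s' := h
      rw [h2]
      exact hF s'
    exact (hF s).symm.unique hSf h1.symm
  · obtain ⟨s, hs⟩ := exists_corresponds hT0 hTf hSf f.symm hθ' t
    exact ⟨s, (hF s).unique hTf hs.symm⟩
end

section
/- Let S and T be countably infinite, congruence-free Boolean inverse ∧-monoids. Then S and T are isomorphic as inverse monoids if, and only if, their groups of units U(S) and U(T) are isomorphic as groups. -/
universe u

/-- A congruence-free monoid: it has exactly two congruences, namely equality
and the universal congruence. -/
def CongruenceFree (S : Type u) [InverseMonoidWithZero S] : Prop :=
  (∃ a b : S, a ≠ b) ∧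
    ∀ c : Con S, (∀ x y : S, c x y ↔ x = y) ∨ (∀ x y : S, c x y)

namespace UnitReconstruction

/-! ### Reconstructing a Boolean algebra from a group acting on it -/

section Action

variable {G B : Type*} [Group G] [BooleanAlgebra B] [MulAction G B]

variable (G) in
/-- The rigid stabilizer of `a`: the group elements acting trivially off `a`. -/
def rist (a : B) : Subgroup G := fixingSubgroup G {f : B | Disjoint f a}

theorem mem_rist {a : B} {g : G} : g ∈ rist G a ↔ ∀ f : B, Disjoint f a → g • f = f := by
  simp [rist, mem_fixingSubgroup_iff]

theorem rist_mono {a b : B} (h : a ≤ b) : rist G a ≤ rist G b := fun _ hg =>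
  mem_rist.2 fun f hf => mem_rist.1 hg f (hf.mono_right h)

variable (G B) in
/-- A faithful action of a group by automorphisms on an atomless Boolean algebra, in which every
element has a support, involutions can be restricted to invariant elements, and any element can be
swapped by an involution into any given nonzero element disjoint from it. -/
structure IsRichAction : Prop where
  smul_mono : ∀ (g : G) (a b : B), a ≤ b → g • a ≤ g • b
  faithful : ∀ g : G, (∀ b : B, g • b = b) → g = 1
  exists_support : ∀ g : G, ∃ a : B, IsLeast {a : B | g ∈ rist G a} a
  exists_cut : ∀ (t : G) (b : B), t * t = 1 → t • b = b →
    ∃ s : G, s * s = 1 ∧ (∀ f ≤ b, s • f = t • f) ∧ ∀ f ≤ bᶜ, s • f = f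
  exists_swap : ∀ e f : B, Disjoint e f → f ≠ ⊥ →
    ∃ g : G, g * g = 1 ∧ g • e ≤ f ∧ g ∈ rist G (e ⊔ g • e)
  atomless : ∀ e : B, e ≠ ⊥ → ∃ f < e, f ≠ ⊥

namespace IsRichAction

variable (H : IsRichAction G B)
include H

theorem smul_le_smul_iff (g : G) {a b : B} : g • a ≤ g • b ↔ a ≤ b :=
  ⟨fun h => by simpa using H.smul_mono g⁻¹ _ _ h, H.smul_mono g a b⟩

theorem smul_sup (g : G) (a b : B) : g • (a ⊔ b) = g • a ⊔ g • b :=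
  map_sup (⟨MulAction.toPerm g, H.smul_le_smul_iff g⟩ : B ≃o B) a b

theorem smul_inf (g : G) (a b : B) : g • (a ⊓ b) = g • a ⊓ g • b :=
  map_inf (⟨MulAction.toPerm g, H.smul_le_smul_iff g⟩ : B ≃o B) a b

theorem smul_compl (g : G) (a : B) : g • aᶜ = (g • a)ᶜ :=
  map_compl' (⟨MulAction.toPerm g, H.smul_le_smul_iff g⟩ : B ≃o B) a

theorem smul_bot (g : G) : g • (⊥ : B) = ⊥ :=
  map_bot (⟨MulAction.toPerm g, H.smul_le_smul_iff g⟩ : B ≃o B)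

theorem smul_eq_bot_iff (g : G) {a : B} : g • a = ⊥ ↔ a = ⊥ := by
  rw [← H.smul_bot g, smul_left_cancel_iff, H.smul_bot g]

theorem disjoint_smul_iff (g : G) {a b : B} : Disjoint (g • a) (g • b) ↔ Disjoint a b := by
  rw [disjoint_iff, disjoint_iff, ← H.smul_inf, H.smul_eq_bot_iff]

theorem conj_mem_rist {g h : G} {a : B} (hg : g ∈ rist G a) : h * g * h⁻¹ ∈ rist G (h • a) :=
  mem_rist.2 fun f hf => by
    rw [mul_smul, mul_smul, mem_rist.1 hg, smul_inv_smul]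
    rwa [← H.disjoint_smul_iff h, smul_inv_smul]

theorem mem_rist_smul_iff {g h : G} {a : B} : g ∈ rist G (h • a) ↔ h⁻¹ * g * h ∈ rist G a :=
  ⟨fun hg => by simpa using H.conj_mem_rist (h := h⁻¹) hg,
    fun hg => by simpa [mul_assoc] using H.conj_mem_rist (h := h) hg⟩

theorem rist_bot : rist G (⊥ : B) = ⊥ :=
  (Subgroup.eq_bot_iff_forall _).2 fun g hg =>
    H.faithful g fun b => mem_rist.1 hg b disjoint_bot_right

theorem mem_rist_inf {g : G} {a b : B} (ha : g ∈ rist G a) (hb : g ∈ rist G b) :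
    g ∈ rist G (a ⊓ b) := mem_rist.2 fun f hf => by
  have h : f = f ⊓ aᶜ ⊔ f ⊓ bᶜ := by
    rw [← inf_sup_left, ← compl_inf]
    exact (inf_eq_left.2 hf.le_compl_right).symm
  rw [h, H.smul_sup, mem_rist.1 ha _ (disjoint_compl_left.mono_left inf_le_right),
    mem_rist.1 hb _ (disjoint_compl_left.mono_left inf_le_right)]

theorem eq_one_of_mem_rist {g : G} {a b : B} (hab : Disjoint a b) (ha : g ∈ rist G a)
    (hb : g ∈ rist G b) : g = 1 := by
  have h := H.mem_rist_inf ha hb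
  rwa [hab.eq_bot, H.rist_bot, Subgroup.mem_bot] at h

theorem commute_of_disjoint {g h : G} {a b : B} (hab : Disjoint a b) (hg : g ∈ rist G a)
    (hh : h ∈ rist G b) : Commute g h := by
  have hga : g • b = b := mem_rist.1 hg b hab.symm
  have hhb : h • a = a := mem_rist.1 hh a hab
  have key : g * h * g⁻¹ * h⁻¹ = 1 := by
    refine H.eq_one_of_mem_rist hab ?_ ?_
    · have := H.conj_mem_rist (h := h) (inv_mem hg)
      rw [hhb] at this
      simpa [mul_assoc] using mul_mem hg this
    · have := H.conj_mem_rist (h := g) hh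
      rw [hga] at this
      exact mul_mem this (inv_mem hh)
  rwa [mul_inv_eq_one, mul_inv_eq_iff_eq_mul] at key

/-- An element that acts nontrivially below `e` moves some part of `e` off itself. -/
theorem exists_disjoint_smul {g : G} {e : B} (hg : ∃ f ≤ e, g • f ≠ f) :
    ∃ c ≤ e, c ≠ ⊥ ∧ Disjoint c (g • c) := by
  obtain ⟨f, hfe, hf⟩ := hg
  by_cases h : f ≤ g • f
  · have h' : ¬ g • f ≤ f := fun h' => hf (le_antisymm h' h)
    refine ⟨f \ g⁻¹ • f, sdiff_le.trans hfe, fun h0 => h' ?_, ?_⟩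
    · rw [sdiff_eq_bot_iff] at h0
      simpa using H.smul_mono g _ _ h0
    · have h1 : g • (f \ g⁻¹ • f) ⊓ f = ⊥ := by
        rw [← smul_inv_smul g f, ← H.smul_inf, smul_inv_smul, H.smul_eq_bot_iff]
        exact disjoint_sdiff_self_left.eq_bot
      exact (disjoint_iff.2 h1).symm.mono_left sdiff_le
  · refine ⟨f \ g • f, sdiff_le.trans hfe, fun h0 => h (sdiff_eq_bot_iff.1 h0), ?_⟩
    exact disjoint_sdiff_self_left.mono_right (H.smul_mono g _ _ sdiff_le)

theorem exists_disjoint_smul_of_notMem {g : G} {a : B} (hg : g ∉ rist G a) :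
    ∃ c, Disjoint c a ∧ c ≠ ⊥ ∧ Disjoint c (g • c) := by
  simp only [mem_rist, not_forall] at hg
  obtain ⟨f, hf, hgf⟩ := hg
  obtain ⟨c, hc, h⟩ := H.exists_disjoint_smul ⟨f, le_rfl, hgf⟩
  exact ⟨c, hf.mono_left hc, h⟩

theorem exists_disjoint_smul_of_support {g : G} {a c : B} (ha : IsLeast {a : B | g ∈ rist G a} a)
    (hc : c ≠ ⊥) (hca : c ≤ a) : ∃ d ≤ c, d ≠ ⊥ ∧ Disjoint d (g • d) := by
  refine H.exists_disjoint_smul ?_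
  by_contra! hfix
  have h1 : g ∈ rist G cᶜ := mem_rist.2 fun f hf => hfix f (disjoint_compl_right_iff.1 hf)
  have h2 : a ≤ cᶜ := ha.2 h1
  exact hc ((le_compl_self).1 (hca.trans h2))

theorem smul_support {g h : G} {a : B} (ha : IsLeast {a : B | g ∈ rist G a} a)
    (hgh : Commute h g) : h • a = a := by
  have key : ∀ k : G, Commute k g → a ≤ k • a := fun k hk => by
    have := H.conj_mem_rist (h := k) ha.1
    rw [hk.eq, mul_inv_cancel_right] at this
    exact ha.2 this
  refine le_antisymm ?_ (key h hgh)
  simpa using H.smul_mono h _ _ (key h⁻¹ hgh.inv_left)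

theorem exists_split {e : B} (he : e ≠ ⊥) :
    ∃ a b : B, a ≠ ⊥ ∧ b ≠ ⊥ ∧ Disjoint a b ∧ a ⊔ b = e := by
  obtain ⟨f, hf, hf0⟩ := H.atomless e he
  refine ⟨f, e \ f, hf0, fun h => ?_, disjoint_sdiff_self_right, sup_sdiff_cancel_right hf.le⟩
  exact hf.not_ge (sdiff_eq_bot_iff.1 h)

theorem exists_mul_self_ne_one {c : B} (hc : c ≠ ⊥) : ∃ g ∈ rist G c, g * g ≠ 1 := by
  obtain ⟨p, q, hp, hq, hpq, rfl⟩ := H.exists_split hc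
  obtain ⟨r, s, hr, hs, hrs, rfl⟩ := H.exists_split hq
  obtain ⟨hpr, hps⟩ := disjoint_sup_right.1 hpq
  obtain ⟨g, hgg, hgp, hg⟩ := H.exists_swap p r hpr hr
  obtain ⟨h, hhh, hhp, hh⟩ := H.exists_swap (g • p) s (hrs.mono_left hgp) hs
  refine ⟨h * g, mul_mem ?_ ?_, fun h1 => hp ?_⟩
  · refine rist_mono (sup_le ?_ ?_) hh
    · exact hgp.trans (le_sup_left.trans le_sup_right)
    · exact hhp.trans (le_sup_right.trans le_sup_right)
  · exact rist_mono (sup_le_sup_left (hgp.trans le_sup_left) _) hg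
  · have h2 : (h * g * (h * g)) • p = g • p := by
      rw [mul_smul, mul_smul, mul_smul, mem_rist.1 hg, smul_smul, hhh, one_smul]
      exact disjoint_sup_right.2 ⟨hps.symm.mono_left hhp, hrs.symm.mono hhp hgp⟩
    rw [h1, one_smul] at h2
    exact disjoint_self.1 (hpr.mono_right (h2.trans_le hgp))

theorem exists_supports (e : B) : ∃ s t : G, s * s = 1 ∧ t * t = 1 ∧ ∃ a b : B,
    IsLeast {a : B | s ∈ rist G a} a ∧ IsLeast {a : B | t ∈ rist G a} b ∧ a ⊔ b = e := by
  have key : ∀ h k : B, Disjoint h k → k ≠ ⊥ → ∃ s : G, s * s = 1 ∧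
      ∃ a, IsLeast {a : B | s ∈ rist G a} a ∧ h ≤ a ∧ a ≤ h ⊔ k := by
    intro h k hhk hk
    obtain ⟨g, hgg, hgh, hg⟩ := H.exists_swap h k hhk hk
    obtain ⟨a, ha⟩ := H.exists_support g
    refine ⟨g, hgg, a, ha, ?_, ha.2 (rist_mono (sup_le_sup_left hgh _) hg)⟩
    have h1 : g • (h \ a) = h \ a := mem_rist.1 ha.1 _ disjoint_sdiff_self_left
    rw [← sdiff_eq_bot_iff, ← disjoint_self]
    nth_rw 2 [← h1]
    exact (hhk.mono_right hgh).mono sdiff_le (H.smul_mono g _ _ sdiff_le)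
  by_cases he : e = ⊥
  · subst he
    have h1 : IsLeast {a : B | (1 : G) ∈ rist G a} ⊥ := ⟨one_mem (rist G ⊥), fun _ _ => bot_le⟩
    exact ⟨1, 1, one_mul 1, one_mul 1, ⊥, ⊥, h1, h1, sup_idem _⟩
  · obtain ⟨h, k, hh, hk, hhk, rfl⟩ := H.exists_split he
    obtain ⟨s, hs, a, ha, hha, hae⟩ := key h k hhk hk
    obtain ⟨t, ht, b, hb, hkb, hbe⟩ := key k h hhk.symm hh
    exact ⟨s, t, hs, ht, a, b, ha, hb,
      le_antisymm (sup_le hae (hbe.trans (sup_comm k h).le)) (sup_le_sup hha hkb)⟩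

theorem rist_le_rist_iff {a b : B} : rist G a ≤ rist G b ↔ a ≤ b := by
  refine ⟨fun h => ?_, rist_mono⟩
  by_contra hab
  obtain ⟨g, hg, hg1⟩ := H.exists_mul_self_ne_one (c := a \ b) (by rwa [Ne, sdiff_eq_bot_iff])
  have : g = 1 := H.eq_one_of_mem_rist disjoint_sdiff_self_left hg (h (rist_mono sdiff_le hg))
  exact hg1 (by rw [this, one_mul])

/-- An element commuting with all squares from a rigid stabilizer lives on the complement. -/
theorem mem_rist_compl {g : G} {a : B} (hg : ∀ h ∈ rist G a, Commute g (h * h)) :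
    g ∈ rist G aᶜ := by
  by_contra hga
  obtain ⟨c, hca, hc, hgc⟩ := H.exists_disjoint_smul_of_notMem hga
  obtain ⟨h, hh, hh1⟩ := H.exists_mul_self_ne_one hc
  have hcomm := hg h (rist_mono (disjoint_compl_right_iff.1 hca) hh)
  have h1 := H.conj_mem_rist (h := g) (mul_mem hh hh)
  rw [hcomm.eq, mul_inv_cancel_right] at h1
  exact hh1 (H.eq_one_of_mem_rist hgc (mul_mem hh hh) h1)

theorem mem_rist_compl_iff {g : G} {a : B} :
    g ∈ rist G aᶜ ↔ ∀ h ∈ rist G a, Commute g h :=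
  ⟨fun hg _ hh => H.commute_of_disjoint disjoint_compl_left hg hh,
    fun hg => H.mem_rist_compl fun _ hh => hg _ (mul_mem hh hh)⟩

end IsRichAction

/-- The involutions centralizing `t` and commuting with all their conjugates under the
centralizer of `t`. -/
def IsLocalInvolution (t s : G) : Prop :=
  s * s = 1 ∧ Commute s t ∧ ∀ a : G, Commute a t → Commute s (a * s * a⁻¹)

/-- The elements commuting with every local involution of `t`. -/
def CommutesLocally (t a : G) : Prop := ∀ s : G, IsLocalInvolution t s → Commute a s

/-- The group-theoretic description of the rigid stabilizer of the support of the
involution `t`. -/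
def InSupportOf (t b : G) : Prop := ∀ a : G, CommutesLocally t a → Commute b (a * a)

/-- The group-theoretic description of the rigid stabilizer of the join of the supports of the
involutions `s` and `t`. -/
def InJoinSupportOf (s t g : G) : Prop :=
  ∀ h : G, (∀ k : G, InSupportOf s k ∨ InSupportOf t k → Commute h k) → Commute g h

theorem inJoinSupportOf_map {G' : Type*} [Group G'] (θ : G ≃* G') (s t g : G) :
    InJoinSupportOf (θ s) (θ t) (θ g) ↔ InJoinSupportOf s t g := by
  simp only [InJoinSupportOf, InSupportOf, CommutesLocally, IsLocalInvolution, Commute,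
    SemiconjBy, θ.surjective.forall, ← map_mul, ← map_inv, θ.injective.eq_iff,
    map_eq_one_iff θ θ.injective]

namespace IsRichAction

variable (H : IsRichAction G B)
include H

theorem mem_rist_of_isLocalInvolution {t s : G} {a : B} (ha : t ∈ rist G a)
    (hs : IsLocalInvolution t s) : s ∈ rist G a := by
  by_contra hsa
  obtain ⟨hss, -, hconj⟩ := hs
  obtain ⟨c, hca, hc, hsc⟩ := H.exists_disjoint_smul_of_notMem hsa
  obtain ⟨g, hg, hg1⟩ := H.exists_mul_self_ne_one hc
  have hgt : Commute g t := H.commute_of_disjoint hca hg ha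
  have hinv : s⁻¹ = s := inv_eq_of_mul_eq_one_left hss
  have hk := H.conj_mem_rist (h := s) hg
  have hgk : Commute g (s * g * s⁻¹) := H.commute_of_disjoint hsc hg hk
  have hcomm := hconj g hgt
  have hsq : s * g * s⁻¹ * (s * g * s⁻¹) = g * g := by
    have h1 : s * g * s⁻¹ = g * (s * g * s⁻¹)⁻¹ * g := by
      have h2 := hcomm.eq
      rw [mul_inv_rev, mul_inv_rev, inv_inv, hinv, ← mul_inv_eq_iff_eq_mul, mul_assoc s g s]
      simpa only [mul_assoc] using h2
    rwa [mul_assoc g, ← hgk.inv_right.eq, ← mul_assoc, eq_mul_inv_iff_mul_eq] at h1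
  refine hg1 (H.eq_one_of_mem_rist hsc (mul_mem hg hg) ?_)
  rw [← hsq]
  exact mul_mem hk hk

/-- Restricting an involution to an invariant part of its support gives a local involution. -/
theorem exists_isLocalInvolution {t : G} {a b : B} (ht : t * t = 1)
    (ha : IsLeast {a : B | t ∈ rist G a} a) (hb : t • b = b) (hba : b ≤ a) :
    ∃ s : G, IsLocalInvolution t s ∧ IsLeast {a : B | s ∈ rist G a} b := by
  obtain ⟨s, hss, hsb, hsb'⟩ := H.exists_cut t b ht hb
  have hext : ∀ g h : G, (∀ f ≤ b, g • f = h • f) → (∀ f ≤ bᶜ, g • f = h • f) → g = h := by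
    intro g h h1 h2
    have : h⁻¹ * g = 1 := H.faithful _ fun f => by
      have hf : f = f ⊓ b ⊔ f ⊓ bᶜ := by rw [← inf_sup_left, sup_compl_eq_top, inf_top_eq]
      rw [mul_smul, inv_smul_eq_iff, hf, H.smul_sup, H.smul_sup, h1 _ inf_le_right,
        h2 _ inf_le_right]
    exact (inv_mul_eq_one.1 this).symm
  have hcomm : ∀ g : G, Commute g t → g • b = b → Commute s g := fun g hgt hgb => by
    refine hext _ _ (fun f hf => ?_) fun f hf => ?_
    · have hgf : g • f ≤ b := hgb ▸ H.smul_mono g _ _ hf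
      rw [mul_smul, mul_smul, hsb _ hgf, hsb _ hf, smul_smul, smul_smul, hgt.eq]
    · have hgf : g • f ≤ bᶜ := by
        rw [← hgb, ← H.smul_compl]
        exact H.smul_mono g _ _ hf
      rw [mul_smul, mul_smul, hsb' _ hgf, hsb' _ hf]
  have hst : Commute s t := hcomm t (Commute.refl t) hb
  refine ⟨s, ⟨hss, hst, fun g hg => hcomm _ ?_ ?_⟩, ?_, fun d hd => ?_⟩
  · exact (hg.mul_left hst).mul_left hg.inv_left
  · have hgb : t • (g⁻¹ • b) = g⁻¹ • b := by
      rw [smul_smul, ← hg.inv_left.eq, mul_smul, hb]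
    have h1 : s • (g⁻¹ • b ⊓ b) = g⁻¹ • b ⊓ b := by
      rw [hsb _ inf_le_right, H.smul_inf, hgb, hb]
    have h2 : s • (g⁻¹ • b ⊓ bᶜ) = g⁻¹ • b ⊓ bᶜ := hsb' _ inf_le_right
    have h3 : s • g⁻¹ • b = g⁻¹ • b := by
      have h4 := H.smul_sup s (g⁻¹ • b ⊓ b) (g⁻¹ • b ⊓ bᶜ)
      rwa [h1, h2, ← inf_sup_left, sup_compl_eq_top, inf_top_eq] at h4
    rw [mul_smul, mul_smul, h3, smul_inv_smul]
  · exact mem_rist.2 fun f hf => hsb' f hf.le_compl_right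
  · by_contra hbd
    obtain ⟨c, hc, hc0, hct⟩ := H.exists_disjoint_smul_of_support ha
      (c := b \ d) (by rwa [Ne, sdiff_eq_bot_iff]) (sdiff_le.trans hba)
    rw [← hsb c (hc.trans sdiff_le), mem_rist.1 hd c (disjoint_sdiff_self_left.mono_left hc),
      disjoint_self] at hct
    exact hc0 hct

theorem mul_self_mem_rist_compl {t g : G} {a : B} (ht : t * t = 1)
    (ha : IsLeast {a : B | t ∈ rist G a} a) (hg : CommutesLocally t g) :
    g * g ∈ rist G aᶜ := by
  by_contra hga
  obtain ⟨c₀, hc₀a, hc₀, hgc₀⟩ := H.exists_disjoint_smul_of_notMem hga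
  rw [disjoint_compl_right_iff] at hc₀a
  obtain ⟨c₁, hc₁c₀, hc₁, htc₁⟩ := H.exists_disjoint_smul_of_support ha hc₀ hc₀a
  have hggc₁ : Disjoint c₁ ((g * g) • c₁) := hgc₀.mono hc₁c₀ (H.smul_mono _ _ _ hc₁c₀)
  obtain ⟨c, hcc₁, hc, hgc⟩ := H.exists_disjoint_smul (g := g) ⟨c₁, le_rfl, fun h => hc₁ (by
    rwa [mul_smul, h, h, disjoint_self] at hggc₁)⟩
  have hca : c ≤ a := hcc₁.trans (hc₁c₀.trans hc₀a)
  have htt : ∀ f : B, t • t • f = f := fun f => by rw [smul_smul, ht, one_smul]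
  have hta : t • a = a := H.smul_support ha (Commute.refl t)
  have horbit : ∀ d ≤ c, g • (d ⊔ t • d) = d ⊔ t • d := fun d hd => by
    obtain ⟨s, hs, hsupp⟩ := H.exists_isLocalInvolution (b := d ⊔ t • d) ht ha
      (by rw [H.smul_sup, htt, sup_comm])
      (sup_le (hd.trans hca) (hta ▸ H.smul_mono t _ _ (hd.trans hca)))
    exact H.smul_support hsupp (hg s hs)
  have hgd : ∀ d ≤ c, g • d ≤ t • d := fun d hd => by
    have h1 : g • d ≤ d ⊔ t • d := horbit d hd ▸ H.smul_mono g _ _ le_sup_left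
    exact Disjoint.left_le_of_le_sup_left h1 (hgc.mono hd (H.smul_mono g _ _ hd)).symm
  have hggc : g • g • c ≤ t • c := by
    have h1 : g • g • c ≤ c ⊔ t • c := by
      rw [← horbit c le_rfl]
      exact H.smul_mono g _ _ ((hgd c le_rfl).trans le_sup_right)
    rw [mul_smul] at hggc₁
    have h2 : Disjoint (g • g • c) c :=
      (hggc₁.mono hcc₁ (H.smul_mono g _ _ (H.smul_mono g _ _ hcc₁))).symm
    exact h2.left_le_of_le_sup_left h1
  have htc : t • g • g • c ≤ c := by simpa [htt] using H.smul_mono t _ _ hggc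
  have h1 : g • t • g • g • c ≤ g • g • c := by simpa [htt] using hgd _ htc
  have h2 : Disjoint (g • t • g • g • c) (g • g • c) :=
    ((H.disjoint_smul_iff g).2 hgc).mono_left (H.smul_mono g _ _ htc)
  have h3 := h2.eq_bot_of_le h1
  rw [H.smul_eq_bot_iff, H.smul_eq_bot_iff, H.smul_eq_bot_iff, H.smul_eq_bot_iff] at h3
  exact hc h3

theorem inSupportOf_iff {t g : G} {a : B} (ht : t * t = 1)
    (ha : IsLeast {a : B | t ∈ rist G a} a) : InSupportOf t g ↔ g ∈ rist G a := by
  refine ⟨fun hg => ?_, fun hg h hh =>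
    H.commute_of_disjoint disjoint_compl_right hg (H.mul_self_mem_rist_compl ht ha hh)⟩
  rw [← compl_compl a]
  exact H.mem_rist_compl fun h hh => hg h fun s hs =>
    H.commute_of_disjoint disjoint_compl_left hh (H.mem_rist_of_isLocalInvolution ha.1 hs)

theorem inJoinSupportOf_iff {s t g : G} {a b : B} (hs : s * s = 1) (ht : t * t = 1)
    (ha : IsLeast {a : B | s ∈ rist G a} a) (hb : IsLeast {a : B | t ∈ rist G a} b) :
    InJoinSupportOf s t g ↔ g ∈ rist G (a ⊔ b) := by
  have key : ∀ h : G, (∀ k : G, InSupportOf s k ∨ InSupportOf t k → Commute h k) ↔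
      h ∈ rist G (a ⊔ b)ᶜ := fun h => by
    simp only [H.inSupportOf_iff hs ha, H.inSupportOf_iff ht hb, or_imp, forall_and,
      ← H.mem_rist_compl_iff, compl_sup]
    exact ⟨fun hh => H.mem_rist_inf hh.1 hh.2,
      fun hh => ⟨rist_mono inf_le_left hh, rist_mono inf_le_right hh⟩⟩
  simp only [InJoinSupportOf, key, ← H.mem_rist_compl_iff, compl_compl]

/-- A group isomorphism carries rigid stabilizers to rigid stabilizers. -/
theorem exists_mem_rist_iff {G' B' : Type*} [Group G'] [BooleanAlgebra B'] [MulAction G' B']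
    (H' : IsRichAction G' B') (θ : G ≃* G') (e : B) :
    ∃ e' : B', ∀ g : G, g ∈ rist G e ↔ θ g ∈ rist G' e' := by
  obtain ⟨s, t, hs, ht, a, b, ha, hb, rfl⟩ := H.exists_supports e
  obtain ⟨a', ha'⟩ := H'.exists_support (θ s)
  obtain ⟨b', hb'⟩ := H'.exists_support (θ t)
  refine ⟨a' ⊔ b', fun g => ?_⟩
  rw [← H.inJoinSupportOf_iff hs ht ha hb, ← inJoinSupportOf_map θ,
    H'.inJoinSupportOf_iff (by rw [← map_mul, hs, map_one]) (by rw [← map_mul, ht, map_one])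
      ha' hb']

/-- Isomorphisms between groups with rich actions are spatial. -/
theorem exists_equivariant_orderIso {G' B' : Type*} [Group G'] [BooleanAlgebra B']
    [MulAction G' B'] (H' : IsRichAction G' B') (θ : G ≃* G') :
    ∃ α : B ≃o B', ∀ (g : G) (b : B), α (g • b) = θ g • α b := by
  choose f hf using H.exists_mem_rist_iff H' θ
  choose f' hf' using H'.exists_mem_rist_iff H θ.symm
  have hle : ∀ a b, f a ≤ f b ↔ a ≤ b := fun a b => by
    rw [← H.rist_le_rist_iff, ← H'.rist_le_rist_iff, SetLike.le_def, SetLike.le_def,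
      θ.surjective.forall]
    simp only [hf]
  have hinj : ∀ a b : B', (∀ g, g ∈ rist G' a ↔ g ∈ rist G' b) → a = b := fun a b h =>
    le_antisymm (H'.rist_le_rist_iff.1 fun g => (h g).1) (H'.rist_le_rist_iff.1 fun g => (h g).2)
  have hsurj : Function.Surjective f := fun b =>
    ⟨f' b, hinj _ _ fun g => by rw [hf' b g, hf, θ.apply_symm_apply]⟩
  refine ⟨RelIso.ofSurjective (OrderEmbedding.ofMapLEIff f hle) hsurj, fun g b => ?_⟩
  refine hinj _ _ (θ.surjective.forall.2 fun k => ?_)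
  change θ k ∈ rist G' (f (g • b)) ↔ θ k ∈ rist G' (θ g • f b)
  rw [← hf, H.mem_rist_smul_iff, H'.mem_rist_smul_iff, hf, map_mul, map_mul, map_inv]

end IsRichAction

end Action

/-! ### Inverse monoids with zero -/

section Inverse

open InverseMonoidWithZero

variable {S : Type u} [InverseMonoidWithZero S]

theorem inv_eq_of_idem {e : S} (he : e * e = e) : e⁻¹ = e :=
  (inv_unique e e (by rw [he, he]) (by rw [he, he])).symm

theorem inv_inv_eq (a : S) : a⁻¹⁻¹ = a :=
  (inv_unique a⁻¹ a (inv_mul_inv a) (mul_inv_mul a)).symm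

theorem mul_idem {e f : S} (he : e * e = e) (hf : f * f = f) : e * f * (e * f) = e * f := by
  have h1 : e * f * (e * f)⁻¹ * (e * f) = e * f := mul_inv_mul (e * f)
  have h2 : (e * f)⁻¹ * (e * f) * (e * f)⁻¹ = (e * f)⁻¹ := inv_mul_inv (e * f)
  generalize hx : (e * f)⁻¹ = x at h1 h2
  have hxe : f * x * e = x := by
    rw [← hx]
    refine inv_unique _ _ ?_ ?_
    · grind
    · grind
  have hxx : x * x = x := by grind
  have h3 : e * f = x⁻¹ := by rw [← hx, inv_inv_eq]
  rw [h3, inv_eq_of_idem hxx, hxx]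

theorem idem_comm {e f : S} (he : e * e = e) (hf : f * f = f) : e * f = f * e := by
  have h1 := mul_idem he hf
  have h2 := mul_idem hf he
  rw [← inv_eq_of_idem h1]
  refine (inv_unique (e * f) (f * e) ?_ ?_).symm <;> grind

theorem inv_mul_self_idem (a : S) : a⁻¹ * a * (a⁻¹ * a) = a⁻¹ * a := by
  rw [← mul_assoc, inv_mul_inv]

theorem mul_inv_self_idem (a : S) : a * a⁻¹ * (a * a⁻¹) = a * a⁻¹ := by
  rw [← mul_assoc, mul_inv_mul]

theorem mul_inv_rev_eq (a b : S) : (a * b)⁻¹ = b⁻¹ * a⁻¹ := by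
  have h := idem_comm (inv_mul_self_idem a) (mul_inv_self_idem b)
  have ha := mul_inv_mul a
  have hb := mul_inv_mul b
  have ha' := inv_mul_inv a
  have hb' := inv_mul_inv b
  refine (inv_unique _ _ ?_ ?_).symm
  · calc a * b * (b⁻¹ * a⁻¹) * (a * b) = a * (b * b⁻¹ * (a⁻¹ * a)) * b := by simp only [mul_assoc]
      _ = a * a⁻¹ * a * (b * b⁻¹ * b) := by rw [← h]; simp only [mul_assoc]
      _ = a * b := by rw [ha, hb]
  · calc b⁻¹ * a⁻¹ * (a * b) * (b⁻¹ * a⁻¹) = b⁻¹ * (a⁻¹ * a * (b * b⁻¹)) * a⁻¹ := by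
          simp only [mul_assoc]
      _ = b⁻¹ * b * b⁻¹ * (a⁻¹ * a * a⁻¹) := by rw [h]; simp only [mul_assoc]
      _ = b⁻¹ * a⁻¹ := by rw [ha', hb']

theorem inv_zero_eq : (0 : S)⁻¹ = 0 := inv_eq_of_idem (zero_mul' 0)

theorem conj_idem (s : S) {e : S} (he : e * e = e) : s * e * s⁻¹ * (s * e * s⁻¹) = s * e * s⁻¹ := by
  calc s * e * s⁻¹ * (s * e * s⁻¹) = s * (e * (s⁻¹ * s)) * e * s⁻¹ := by simp only [mul_assoc]
    _ = s * s⁻¹ * s * (e * e) * s⁻¹ := by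
      rw [idem_comm he (inv_mul_self_idem s)]; simp only [mul_assoc]
    _ = s * e * s⁻¹ := by rw [mul_inv_mul, he]

theorem mul_conj_mul (s : S) {e f : S} (he : e * e = e) :
    s * e * s⁻¹ * (s * f * s⁻¹) = s * (e * f) * s⁻¹ := by
  calc s * e * s⁻¹ * (s * f * s⁻¹) = s * (e * (s⁻¹ * s)) * f * s⁻¹ := by simp only [mul_assoc]
    _ = s * s⁻¹ * s * (e * f) * s⁻¹ := by
      rw [idem_comm he (inv_mul_self_idem s)]; simp only [mul_assoc]
    _ = s * (e * f) * s⁻¹ := by rw [mul_inv_mul]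

theorem units_inv (g : Sˣ) : (g : S)⁻¹ = ((g⁻¹ : Sˣ) : S) :=
  (inv_unique _ _ (by simp) (by simp)).symm

theorem nle_antisymm {a b : S} (hab : nle a b) (hba : nle b a) : a = b := by
  obtain ⟨e, he, rfl⟩ := hab
  obtain ⟨f, hf, h⟩ := hba
  have hfb : f * b = b := by rw [h, ← mul_assoc, hf]
  calc e * b = e * (f * b) := by rw [hfb]
    _ = f * (e * b) := by rw [← mul_assoc, idem_comm he hf, mul_assoc]
    _ = b := h.symm

theorem nle_idem_iff {e f : S} (he : e * e = e) (hf : f * f = f) : nle e f ↔ e * f = e := by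
  refine ⟨?_, fun h => ⟨e, he, h.symm⟩⟩
  rintro ⟨h, -, rfl⟩
  rw [mul_assoc, hf]

theorem compat_of_idem {e f : S} (he : e * e = e) (hf : f * f = f) : Compat e f := by
  rw [Compat, inv_eq_of_idem he, inv_eq_of_idem hf]
  exact ⟨mul_idem he hf, mul_idem he hf⟩

theorem _root_.Orth.compat {a b : S} (h : Orth a b) : Compat a b := by
  rw [Compat, h.1, h.2]
  exact ⟨zero_mul' 0, zero_mul' 0⟩

theorem _root_.Orth.symm {a b : S} (h : Orth a b) : Orth b a := by
  constructor
  · rw [← inv_inv_eq (b * a⁻¹), mul_inv_rev_eq, inv_inv_eq, h.1, inv_zero_eq]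
  · rw [← inv_inv_eq (b⁻¹ * a), mul_inv_rev_eq, inv_inv_eq, h.2, inv_zero_eq]

theorem _root_.Orth.mul_mul_inv {a b e : S} (h : Orth a b) (he : e * e = e) :
    a * e * b⁻¹ = 0 := by
  calc a * e * b⁻¹ = a * (a⁻¹ * a * e) * b⁻¹ := by rw [← mul_assoc, ← mul_assoc, mul_inv_mul]
    _ = a * e * a⁻¹ * (a * b⁻¹) := by
      rw [idem_comm (inv_mul_self_idem a) he]; simp only [mul_assoc]
    _ = 0 := by rw [h.1, mul_zero']

theorem orth_of_idem_mul_eq_zero {e f : S} (he : e * e = e) (hf : f * f = f) (h : e * f = 0) :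
    Orth e f := by
  rw [Orth, inv_eq_of_idem he, inv_eq_of_idem hf]
  exact ⟨h, h⟩

theorem _root_.Orth.inv {a b : S} (h : Orth a b) : Orth a⁻¹ b⁻¹ := by
  rw [Orth, inv_inv_eq, inv_inv_eq]
  exact ⟨h.2, h.1⟩

theorem inv_mul_eq_zero_of_range {a b : S} (h : a * a⁻¹ * (b * b⁻¹) = 0) : a⁻¹ * b = 0 := by
  calc a⁻¹ * b = a⁻¹ * a * a⁻¹ * (b * b⁻¹ * b) := by rw [mul_inv_mul, inv_mul_inv]
    _ = a⁻¹ * (a * a⁻¹ * (b * b⁻¹)) * b := by simp only [mul_assoc]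
    _ = 0 := by rw [h, mul_zero', zero_mul']

variable (S) in
/-- The idempotents of an inverse monoid. -/
@[ext]
structure Idem where
  val : S
  mul_self : val * val = val

/-- An inverse monoid acts on its idempotents by conjugation. -/
instance : MulAction S (Idem S) where
  smul s e := ⟨s * e.1 * s⁻¹, conj_idem s e.2⟩
  one_smul e := Idem.ext (by
    change 1 * e.1 * 1⁻¹ = e.1
    rw [inv_eq_of_idem (one_mul 1), one_mul, mul_one])
  mul_smul s t e := Idem.ext (by
    change s * t * e.1 * (s * t)⁻¹ = s * (t * e.1 * t⁻¹) * s⁻¹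
    rw [mul_inv_rev_eq]
    simp only [mul_assoc])

theorem Idem.smul_val (s : S) (e : Idem S) : (s • e).1 = s * e.1 * s⁻¹ := rfl

theorem _root_.CongruenceFree.zero_ne_one (hS : CongruenceFree S) : (0 : S) ≠ 1 := fun h => by
  obtain ⟨⟨a, b, hab⟩, -⟩ := hS
  exact hab (by rw [← one_mul a, ← one_mul b, ← h, zero_mul', zero_mul'])

/-- In a congruence-free inverse monoid, the identity is equivalent to an idempotent below any
given nonzero idempotent. -/
theorem _root_.CongruenceFree.exists_inv_mul_eq_one (hS : CongruenceFree S) {e : S} (he : e * e = e)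
    (he0 : e ≠ 0) : ∃ x : S, x⁻¹ * x = 1 ∧ e * x = x := by
  let c : Con S :=
    { r := fun x y => x = y ∨ (∃ a b, x = a * e * b) ∧ ∃ a b, y = a * e * b
      iseqv := by
        refine ⟨fun x => Or.inl rfl, ?_, ?_⟩
        · rintro x y (rfl | ⟨h, h'⟩)
          · exact Or.inl rfl
          · exact Or.inr ⟨h', h⟩
        · rintro x y z (rfl | ⟨h, h'⟩) (rfl | ⟨k, k'⟩)
          · exact Or.inl rfl
          · exact Or.inr ⟨k, k'⟩
          · exact Or.inr ⟨h, h'⟩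
          · exact Or.inr ⟨h, k'⟩
      mul' := by
        have hr : ∀ x y : S, (∃ a b, x = a * e * b) → ∃ a b, x * y = a * e * b := by
          rintro _ y ⟨a, b, rfl⟩
          exact ⟨a, b * y, by simp only [mul_assoc]⟩
        have hl : ∀ x y : S, (∃ a b, y = a * e * b) → ∃ a b, x * y = a * e * b := by
          rintro x _ ⟨a, b, rfl⟩
          exact ⟨x * a, b, by simp only [mul_assoc]⟩
        rintro w x y z (rfl | ⟨h, h'⟩) (rfl | ⟨k, k'⟩)
        · exact Or.inl rfl
        · exact Or.inr ⟨hl _ _ k, hl _ _ k'⟩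
        · exact Or.inr ⟨hr _ _ h, hr _ _ h'⟩
        · exact Or.inr ⟨hr _ _ h, hr _ _ h'⟩ }
  have h0 : ∃ a b : S, 0 = a * e * b := ⟨0, 0, by rw [mul_zero']⟩
  rcases hS.2 c with hc | hc
  · refine absurd ((hc e 0).1 (Or.inr ⟨⟨1, 1, by simp⟩, h0⟩)) he0
  · rcases hc 1 0 with h | ⟨⟨a, b, h⟩, -⟩
    · exact absurd h.symm hS.zero_ne_one
    · refine ⟨e * b, ?_, by rw [← mul_assoc, he]⟩
      calc (e * b)⁻¹ * (e * b) = a * e * b * ((e * b)⁻¹ * (e * b)) := by rw [← h, one_mul]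
        _ = a * (e * b * (e * b)⁻¹ * (e * b)) := by simp only [mul_assoc]
        _ = 1 := by rw [mul_inv_mul, ← mul_assoc, ← h]

/-- A congruence-free inverse monoid acts faithfully on its idempotents. -/
theorem _root_.CongruenceFree.eq_of_smul_eq (hS : CongruenceFree S) {a b : S}
    (h : ∀ e : Idem S, a • e = b • e) : a = b := by
  rcases hS.2 (Con.ker (MulAction.toEndHom : S →* Function.End (Idem S))) with hc | hc
  · exact (hc a b).1 (funext h)
  · have h1 := congrArg Idem.val (congrFun (hc 0 1) (⟨1, one_mul 1⟩ : Idem S))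
    refine absurd ?_ hS.zero_ne_one
    change (0 : S) * 1 * 0⁻¹ = 1 * 1 * 1⁻¹ at h1
    rwa [mul_one, zero_mul', mul_one, one_mul, inv_eq_of_idem (one_mul 1)] at h1

end Inverse

/-! ### Boolean inverse monoids -/

section Distributive

open InverseMonoidWithZero DistributiveInverseMonoid

variable {S : Type u} [DistributiveInverseMonoid S]

theorem sup_idem_of_idem {e f : S} (he : e * e = e) (hf : f * f = f) :
    sup e f * sup e f = sup e f := by
  obtain ⟨h, hh, h1⟩ := sup_le e f 1 (compat_of_idem he hf) ⟨e, he, (mul_one e).symm⟩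
    ⟨f, hf, (mul_one f).symm⟩
  rw [h1, mul_one, hh]

theorem zero_nle (a : S) : nle 0 a := ⟨0, zero_mul' 0, (zero_mul' a).symm⟩

theorem nle_refl (a : S) : nle a a := ⟨1, one_mul 1, (one_mul a).symm⟩

theorem orth_zero_right (a : S) : Orth a 0 := by
  rw [Orth, inv_zero_eq]
  exact ⟨mul_zero' _, mul_zero' _⟩

theorem orth_zero_left (a : S) : Orth 0 a := by
  rw [Orth, inv_zero_eq]
  exact ⟨zero_mul' _, zero_mul' _⟩

theorem sup_zero_right (a : S) : sup a 0 = a :=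
  nle_antisymm (sup_le _ _ _ (orth_zero_right a).compat (nle_refl a) (zero_nle a))
    (le_sup_left _ _ (orth_zero_right a).compat)

theorem sup_zero_left (a : S) : sup 0 a = a :=
  nle_antisymm (sup_le _ _ _ (orth_zero_left a).compat (zero_nle a) (nle_refl a))
    (le_sup_right _ _ (orth_zero_left a).compat)

/-- Products of joins of orthogonal pairs, when the mixed products vanish. -/
theorem sup_mul_sup {a b c d : S} (hab : Orth a b) (hcd : Orth c d) (had : a * d = 0)
    (hbc : b * c = 0) : sup a b * sup c d = sup (a * c) (b * d) := by
  rw [sup_mul _ _ _ hab.compat, mul_sup _ _ _ hcd.compat, mul_sup _ _ _ hcd.compat, had, hbc,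
    sup_zero_right, sup_zero_left]

theorem sup_comm_of_orth {a b : S} (h : Orth a b) : sup a b = sup b a :=
  have h' := h.symm
  nle_antisymm (sup_le _ _ _ h.compat (le_sup_right _ _ h'.compat) (le_sup_left _ _ h'.compat))
    (sup_le _ _ _ h'.compat (le_sup_right _ _ h.compat) (le_sup_left _ _ h.compat))

theorem sup_inv {a b : S} (h : Orth a b) : (sup a b)⁻¹ = sup a⁻¹ b⁻¹ := by
  have h' := h.symm
  have h1 : sup a b * sup a⁻¹ b⁻¹ = sup (a * a⁻¹) (b * b⁻¹) := sup_mul_sup h h.inv h.1 h'.1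
  have h2 : sup a⁻¹ b⁻¹ * sup a b = sup (a⁻¹ * a) (b⁻¹ * b) := sup_mul_sup h.inv h h.2 h'.2
  have hr : Orth (a * a⁻¹) (b * b⁻¹) :=
    orth_of_idem_mul_eq_zero (mul_inv_self_idem a) (mul_inv_self_idem b) (by
      rw [mul_assoc, ← mul_assoc a⁻¹, h.2, zero_mul', mul_zero'])
  have hd : Orth (a⁻¹ * a) (b⁻¹ * b) :=
    orth_of_idem_mul_eq_zero (inv_mul_self_idem a) (inv_mul_self_idem b) (by
      rw [mul_assoc, ← mul_assoc a, h.1, zero_mul', mul_zero'])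
  refine (inv_unique _ _ ?_ ?_).symm
  · rw [h1, sup_mul_sup hr h, mul_inv_mul, mul_inv_mul]
    · rw [mul_assoc, h.2, mul_zero']
    · rw [mul_assoc, h'.2, mul_zero']
  · rw [h2, sup_mul_sup hd h.inv, inv_mul_inv, inv_mul_inv]
    · rw [mul_assoc, h.1, mul_zero']
    · rw [mul_assoc, h'.1, mul_zero']

end Distributive

section Boolean

open InverseMonoidWithZero DistributiveInverseMonoid BooleanInverseMonoid

variable {S : Type u} [BooleanInverseMonoid S]

namespace Idem

instance : PartialOrder (Idem S) where
  le e f := e.1 * f.1 = e.1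
  le_refl e := e.2
  le_trans e f g (h : e.1 * f.1 = e.1) (h' : f.1 * g.1 = f.1) := by
    rw [← h, mul_assoc, h']
  le_antisymm e f (h : e.1 * f.1 = e.1) (h' : f.1 * e.1 = f.1) :=
    Idem.ext (by rw [← h, idem_comm e.2 f.2, h'])

theorem le_iff {e f : Idem S} : e ≤ f ↔ e.1 * f.1 = e.1 := Iff.rfl

instance : Lattice (Idem S) where
  sup e f := ⟨sup e.1 f.1, sup_idem_of_idem e.2 f.2⟩
  inf e f := ⟨e.1 * f.1, mul_idem e.2 f.2⟩
  le_sup_left e f := (nle_idem_iff e.2 (sup_idem_of_idem e.2 f.2)).1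
    (DistributiveInverseMonoid.le_sup_left _ _ (compat_of_idem e.2 f.2))
  le_sup_right e f := (nle_idem_iff f.2 (sup_idem_of_idem e.2 f.2)).1
    (DistributiveInverseMonoid.le_sup_right _ _ (compat_of_idem e.2 f.2))
  sup_le e f g h h' := (nle_idem_iff (sup_idem_of_idem e.2 f.2) g.2).1
    (DistributiveInverseMonoid.sup_le _ _ _ (compat_of_idem e.2 f.2)
      ((nle_idem_iff e.2 g.2).2 h) ((nle_idem_iff f.2 g.2).2 h'))
  inf_le_left e f := show e.1 * f.1 * e.1 = e.1 * f.1 by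
    rw [idem_comm e.2 f.2, mul_assoc, e.2]
  inf_le_right e f := by rw [le_iff, mul_assoc, f.2]
  le_inf e f g h h' := by rw [le_iff, ← mul_assoc, le_iff.1 h, le_iff.1 h']

theorem inf_val (e f : Idem S) : (e ⊓ f).1 = e.1 * f.1 := rfl

theorem sup_val (e f : Idem S) : (e ⊔ f).1 = sup e.1 f.1 := rfl

instance : DistribLattice (Idem S) :=
  .ofInfSupLe fun _ f g => (Idem.ext (mul_sup _ _ _ (compat_of_idem f.2 g.2))).le

instance : BooleanAlgebra (Idem S) where
  top := ⟨1, one_mul 1⟩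
  bot := ⟨0, zero_mul' 0⟩
  compl e := ⟨compl e.1, compl_idem _ e.2⟩
  le_top e := mul_one e.1
  bot_le e := zero_mul' e.1
  inf_compl_le_bot e := (Idem.ext (mul_compl e.1 e.2)).le
  top_le_sup_compl e := (Idem.ext (sup_compl e.1 e.2)).ge

theorem top_val : (⊤ : Idem S).1 = 1 := rfl

theorem bot_val : (⊥ : Idem S).1 = 0 := rfl

theorem disjoint_iff_mul {e f : Idem S} : Disjoint e f ↔ e.1 * f.1 = 0 := by
  rw [disjoint_iff, Idem.ext_iff, inf_val, bot_val]

theorem mul_compl_val (e : Idem S) : e.1 * eᶜ.1 = 0 := mul_compl e.1 e.2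

theorem compl_mul_val (e : Idem S) : eᶜ.1 * e.1 = 0 := by
  rw [idem_comm eᶜ.2 e.2, mul_compl_val]

theorem sup_compl_val (e : Idem S) : sup e.1 eᶜ.1 = 1 := sup_compl e.1 e.2

theorem smul_top_val (s : S) : (s • (⊤ : Idem S)).1 = s * s⁻¹ := by
  rw [smul_val, top_val, mul_one]

theorem inv_smul_top_val (s : S) : (s⁻¹ • (⊤ : Idem S)).1 = s⁻¹ * s := by
  rw [smul_top_val, inv_inv_eq]

theorem smul_mono (s : S) {e f : Idem S} (h : e ≤ f) : s • e ≤ s • f := by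
  rw [le_iff, smul_val, smul_val, mul_conj_mul _ e.2, le_iff.1 h]

theorem smul_eq_inf (e f : Idem S) : e.1 • f = e ⊓ f := Idem.ext (by
  rw [smul_val, inf_val, inv_eq_of_idem e.2, mul_assoc, idem_comm f.2 e.2, ← mul_assoc, e.2])

theorem smul_of_le {e f : Idem S} (h : f ≤ e) : e.1 • f = f := by
  rw [smul_eq_inf, inf_eq_right.2 h]

theorem smul_eq_of_mul_eq {s t : S} {e f : Idem S} (h : s * e.1 = t * e.1) (hf : f ≤ e) :
    s • f = t • f := by
  rw [← smul_of_le hf, ← mul_smul, ← mul_smul, h]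

theorem smul_bot (s : S) : s • (⊥ : Idem S) = ⊥ :=
  Idem.ext (by rw [smul_val, bot_val, mul_zero', zero_mul'])

theorem sup_smul {a b : S} (h : Orth a b) (e : Idem S) : sup a b • e = a • e ⊔ b • e := by
  have he : Orth (a * e.1) (b * e.1) := by
    rw [Orth, mul_inv_rev_eq, mul_inv_rev_eq, inv_eq_of_idem e.2, mul_assoc, ← mul_assoc e.1, e.2,
      ← mul_assoc, h.mul_mul_inv e.2, mul_assoc, ← mul_assoc a⁻¹, h.2, zero_mul', mul_zero']
    exact ⟨rfl, rfl⟩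
  refine Idem.ext ?_
  rw [smul_val, sup_val, smul_val, smul_val, sup_inv h, sup_mul _ _ _ h.compat,
    sup_mul_sup he h.inv (h.mul_mul_inv e.2) (h.symm.mul_mul_inv e.2)]

end Idem

/-- An involution of a corner extends to an involution of the monoid, trivial on the
complementary corner. -/
theorem exists_unit_of_mul_self {a : S} {p : Idem S} (ha : a * a = p.1) (hpa : p.1 * a = a) :
    ∃ g : Sˣ, g * g = 1 ∧ g * p.1 = a ∧ g * pᶜ.1 = pᶜ.1 := by
  have hap : a * p.1 = a := by rw [← ha, ← mul_assoc, ha, hpa]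
  have hinv : a⁻¹ = a := (inv_unique a a (by rw [ha, hpa]) (by rw [ha, hpa])).symm
  have h1 : a * pᶜ.1 = 0 := by rw [← hap, mul_assoc, p.mul_compl_val, mul_zero']
  have h2 : pᶜ.1 * a = 0 := by rw [← hpa, ← mul_assoc, p.compl_mul_val, zero_mul']
  have horth : Orth a pᶜ.1 := by
    rw [Orth, inv_eq_of_idem pᶜ.2, hinv]
    exact ⟨h1, h1⟩
  have hg : sup a pᶜ.1 * sup a pᶜ.1 = 1 := by
    rw [sup_mul_sup horth horth h1 h2, ha, pᶜ.2, p.sup_compl_val]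
  refine ⟨⟨sup a pᶜ.1, sup a pᶜ.1, hg, hg⟩, Units.ext hg, ?_, ?_⟩
  · change sup a pᶜ.1 * p.1 = a
    rw [sup_mul _ _ _ horth.compat, hap, p.compl_mul_val, sup_zero_right]
  · change sup a pᶜ.1 * pᶜ.1 = pᶜ.1
    rw [sup_mul _ _ _ horth.compat, h1, pᶜ.2, sup_zero_left]

/-- An element with disjoint domain and range lies below an involution supported on their join. -/
theorem exists_unit_of_disjoint {s : S} {d r : Idem S} (hd : s⁻¹ * s = d.1) (hr : s * s⁻¹ = r.1)
    (hdr : Disjoint d r) :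
    ∃ g : Sˣ, g * g = 1 ∧ g * d.1 = s ∧ g * (d ⊔ r)ᶜ.1 = (d ⊔ r)ᶜ.1 := by
  have hsd : s * d.1 = s := by rw [← hd, ← mul_assoc, mul_inv_mul]
  have hrs : r.1 * s = s := by rw [← hr, mul_inv_mul]
  have hds : d.1 * s⁻¹ = s⁻¹ := by rw [← hd, inv_mul_inv]
  have hsr : s⁻¹ * r.1 = s⁻¹ := by rw [← hr, ← mul_assoc, inv_mul_inv]
  have hdr0 : d.1 * r.1 = 0 := Idem.disjoint_iff_mul.1 hdr
  have hrd0 : r.1 * d.1 = 0 := Idem.disjoint_iff_mul.1 hdr.symm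
  have hss : s * s = 0 := by
    calc s * s = s * d.1 * (r.1 * s) := by rw [hsd, hrs]
      _ = s * (d.1 * r.1) * s := by simp only [mul_assoc]
      _ = 0 := by rw [hdr0, mul_zero', zero_mul']
  have hss' : s⁻¹ * s⁻¹ = 0 := by rw [← mul_inv_rev_eq, hss, inv_zero_eq]
  have horth : Orth s s⁻¹ := by
    rw [Orth, inv_inv_eq]
    exact ⟨hss, hss'⟩
  have hrd' : Orth r.1 d.1 := orth_of_idem_mul_eq_zero r.2 d.2 hrd0
  have hp : sup s s⁻¹ * sup s s⁻¹ = (r ⊔ d).1 := by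
    nth_rw 2 [sup_comm_of_orth horth]
    rw [sup_mul_sup horth horth.symm hss hss', hr, hd, Idem.sup_val]
  have hpa : (r ⊔ d).1 * sup s s⁻¹ = sup s s⁻¹ := by
    rw [Idem.sup_val, sup_mul_sup hrd' horth, hrs, hds]
    · rw [← hds, ← mul_assoc, hrd0, zero_mul']
    · rw [← hrs, ← mul_assoc, hdr0, zero_mul']
  obtain ⟨g, hgg, hgp, hgc⟩ := exists_unit_of_mul_self hp hpa
  rw [sup_comm d r]
  refine ⟨g, hgg, ?_, hgc⟩
  have hpd : (r ⊔ d).1 * d.1 = d.1 := by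
    rw [idem_comm (r ⊔ d).2 d.2]
    exact Idem.le_iff.1 le_sup_right
  rw [← hpd, ← mul_assoc, hgp, sup_mul _ _ _ horth.compat, hsd, ← hsr, mul_assoc, hrd0, mul_zero',
    sup_zero_right]

end Boolean

/-! ### The action of the units on the idempotents -/

section CongruenceFree

open InverseMonoidWithZero DistributiveInverseMonoid

section

variable {S : Type u} [BooleanInverseMonoid S] (hS : CongruenceFree S)
include hS

theorem _root_.CongruenceFree.mem_rist_iff {g : Sˣ} {a : Idem S} :
    g ∈ rist Sˣ a ↔ g * aᶜ.1 = aᶜ.1 := by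
  rw [mem_rist]
  refine ⟨fun h => hS.eq_of_smul_eq fun e => ?_, fun h f hf => ?_⟩
  · rw [mul_smul, Idem.smul_eq_inf]
    exact h _ (disjoint_compl_left.mono_left inf_le_left)
  · exact (Idem.smul_eq_of_mul_eq (h.trans (one_mul _).symm) hf.le_compl_right).trans (one_smul S f)

theorem _root_.CongruenceFree.exists_swap {e f : Idem S} (hef : Disjoint e f) (hf : f ≠ ⊥) :
    ∃ g : Sˣ, g * g = 1 ∧ g • e ≤ f ∧ g ∈ rist Sˣ (e ⊔ g • e) := by
  obtain ⟨x, hx, hfx⟩ := hS.exists_inv_mul_eq_one f.2 fun h => hf (Idem.ext h)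
  have hxf : x • e ≤ f := by
    rw [Idem.le_iff, idem_comm (x • e).2 f.2, Idem.smul_val, ← mul_assoc, ← mul_assoc, hfx]
  have hd : (x * e.1)⁻¹ * (x * e.1) = e.1 := by
    rw [mul_inv_rev_eq, inv_eq_of_idem e.2, mul_assoc, ← mul_assoc x⁻¹, hx, one_mul, e.2]
  have hr : x * e.1 * (x * e.1)⁻¹ = (x • e).1 := by
    rw [mul_inv_rev_eq, inv_eq_of_idem e.2, ← mul_assoc, mul_assoc x, e.2, Idem.smul_val]
  obtain ⟨g, hgg, hge, hgc⟩ := exists_unit_of_disjoint hd hr (hef.mono_right hxf)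
  have hgx : g • e = x • e := Idem.smul_eq_of_mul_eq hge le_rfl
  refine ⟨g, hgg, hgx ▸ hxf, ?_⟩
  rwa [hgx, hS.mem_rist_iff]

theorem _root_.CongruenceFree.atomless [Infinite S] {e : Idem S} (he : e ≠ ⊥) :
    ∃ f < e, f ≠ ⊥ := by
  by_contra! hatom
  obtain ⟨x, hx, hex⟩ := hS.exists_inv_mul_eq_one e.2 fun h => he (Idem.ext h)
  have hcancel : ∀ f : Idem S, x⁻¹ • x • f = f := fun f => by rw [smul_smul, hx, one_smul]
  have hxe : ∀ f : Idem S, x • f = ⊥ ∨ x • f = e := fun f => by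
    have hle : x • f ≤ e := by
      rw [← inf_eq_right, ← Idem.smul_eq_inf, smul_smul, hex]
    exact hle.lt_or_eq.imp_left (hatom _)
  have hbot : ∀ f : Idem S, x • f = ⊥ → f = ⊥ := fun f hf => by
    rw [← hcancel f, hf, Idem.smul_bot]
  have htriv : ∀ f : Idem S, f = ⊥ ∨ f = ⊤ := fun f => by
    refine (hxe f).imp (hbot f) fun hf => ?_
    rcases hxe ⊤ with h | h
    · exact (eq_bot_of_bot_eq_top (hbot ⊤ h).symm f).trans (hbot ⊤ h).symm
    · rw [← hcancel f, hf, ← h, hcancel]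
  have hinj : Function.Injective fun s : S => s • (⊤ : Idem S) = ⊤ := fun s t hst => by
    refine hS.eq_of_smul_eq fun f => ?_
    rcases htriv f with rfl | rfl
    · rw [Idem.smul_bot, Idem.smul_bot]
    · have hst' : s • (⊤ : Idem S) = ⊤ ↔ t • (⊤ : Idem S) = ⊤ := iff_of_eq hst
      rcases htriv (t • ⊤) with h | h
      · rcases htriv (s • ⊤) with h' | h'
        · rw [h, h']
        · rw [h', hst'.1 h']
      · rw [h, hst'.2 h]
  exact not_finite_iff_infinite.2 ‹Infinite S› (Finite.of_injective _ hinj)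

/-- An element whose domain and range do not cover the identity lies below a unit. -/
theorem _root_.CongruenceFree.exists_unit_of_sup_ne_top {s : S} {d r : Idem S}
    (hd : s⁻¹ * s = d.1) (hr : s * s⁻¹ = r.1) (hdr : d ⊔ r ≠ ⊤) : ∃ g : Sˣ, s = g * d.1 := by
  obtain ⟨hdc, hrc⟩ := disjoint_sup_left.1 (disjoint_compl_right (a := d ⊔ r))
  obtain ⟨g, -, hgd, -⟩ := hS.exists_swap hdc fun h => hdr (compl_eq_bot.1 h)
  have hsd : s * d.1 = s := by rw [← hd, ← mul_assoc, mul_inv_mul]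
  have hgval : (g • d).1 = g * d.1 * (g⁻¹ : Sˣ) := by
    rw [Units.smul_def, Idem.smul_val, units_inv]
  have hinv : (s * (g⁻¹ : Sˣ))⁻¹ = g * s⁻¹ := by rw [mul_inv_rev_eq, units_inv, inv_inv]
  obtain ⟨h, -, hh, -⟩ := exists_unit_of_disjoint (s := s * (g⁻¹ : Sˣ)) (d := g • d) (r := r)
    (by rw [hinv, hgval, mul_assoc (g : S), ← mul_assoc s⁻¹, hd, ← mul_assoc])
    (by rw [hinv, mul_assoc, Units.inv_mul_cancel_left, hr]) (hrc.mono_right hgd).symm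
  refine ⟨h * g, ?_⟩
  rw [hgval, ← mul_assoc, ← mul_assoc] at hh
  rw [Units.val_mul, ← (Units.mul_left_inj g⁻¹), hh]

end

variable {S : Type u} [BooleanInverseMeetMonoid S]

open BooleanInverseMeetMonoid

theorem _root_.CongruenceFree.isRichAction [Infinite S] (hS : CongruenceFree S) :
    IsRichAction Sˣ (Idem S) where
  smul_mono g _ _ h := Idem.smul_mono (g : S) h
  faithful g h := Units.ext (hS.eq_of_smul_eq fun e => (h e).trans (one_smul S e).symm)
  exists_support g := by
    obtain ⟨e, he, hp1⟩ := inf_le_right (g : S) 1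
    obtain ⟨f, hf, hpg⟩ := inf_le_left (g : S) 1
    rw [mul_one] at hp1
    rw [hp1] at hpg
    have hef : e = f := by
      calc e = e * e⁻¹ := by rw [inv_eq_of_idem he, he]
        _ = f := by
          rw [hpg, mul_inv_rev_eq, units_inv, inv_eq_of_idem hf, mul_assoc,
            Units.mul_inv_cancel_left, hf]
    have hge : g * e = e := by
      calc g * e = g * e⁻¹ := by rw [inv_eq_of_idem he]
        _ = f := by
          rw [hpg, mul_inv_rev_eq, units_inv, inv_eq_of_idem hf, Units.mul_inv_cancel_left]
        _ = e := hef.symm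
    refine ⟨(⟨e, he⟩ : Idem S)ᶜ, ?_, fun b hb => ?_⟩
    · rw [Set.mem_ofPred_eq, hS.mem_rist_iff, compl_compl]
      exact hge
    · have hgb : g * bᶜ.1 = bᶜ.1 := hS.mem_rist_iff.1 hb
      rw [compl_le_iff_compl_le, Idem.le_iff, ← nle_idem_iff bᶜ.2 he, ← hp1]
      refine le_inf _ _ _ ⟨bᶜ.1, bᶜ.2, ?_⟩ ⟨bᶜ.1, bᶜ.2, (mul_one _).symm⟩
      rw [← Units.mul_inv_eq_iff_eq_mul, ← units_inv]
      nth_rw 1 [← inv_eq_of_idem bᶜ.2]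
      rw [← mul_inv_rev_eq, hgb, inv_eq_of_idem bᶜ.2]
  exists_cut t b ht htb := by
    have htb' : t * b.1 = b.1 * t := by
      have h := congrArg Idem.val htb
      rw [Units.smul_def, Idem.smul_val, units_inv] at h
      exact (Units.mul_inv_eq_iff_eq_mul t).1 h
    have ht' : (t : S) * t = 1 := by rw [← Units.val_mul, ht, Units.val_one]
    obtain ⟨g, hgg, hgb, hgc⟩ := exists_unit_of_mul_self (a := t * b.1) (p := b)
      (by rw [mul_assoc, ← mul_assoc b.1, ← htb', mul_assoc, b.2, ← mul_assoc, ht', one_mul])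
      (by rw [← mul_assoc, ← htb', mul_assoc, b.2])
    exact ⟨g, hgg, fun f hf => Idem.smul_eq_of_mul_eq hgb hf, fun f hf =>
      (Idem.smul_eq_of_mul_eq (hgc.trans (one_mul _).symm) hf).trans (one_smul S f)⟩
  exists_swap _ _ hef hf := hS.exists_swap hef hf
  atomless _ he := hS.atomless he

/-- An element that is not a unit is a join of two orthogonal elements, neither of which has
domain and range covering the identity. -/
theorem _root_.CongruenceFree.exists_orth_sup_eq [Infinite S] (hS : CongruenceFree S) {s : S}
    (hs : s⁻¹ • (⊤ : Idem S) ≠ ⊤ ∨ s • (⊤ : Idem S) ≠ ⊤) :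
    ∃ a b : S, Orth a b ∧ s = sup a b ∧
      a⁻¹ • (⊤ : Idem S) ⊔ a • ⊤ ≠ ⊤ ∧ b⁻¹ • (⊤ : Idem S) ⊔ b • ⊤ ≠ ⊤ := by
  have key : ∀ s : S, s⁻¹ • (⊤ : Idem S) ≠ ⊤ → ∃ a b : S, Orth a b ∧ s = sup a b ∧
      a⁻¹ • (⊤ : Idem S) ⊔ a • ⊤ ≠ ⊤ ∧ b⁻¹ • (⊤ : Idem S) ⊔ b • ⊤ ≠ ⊤ := by
    intro s hs
    obtain ⟨p, q, hp, hq, hpq, hsplit⟩ :=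
      hS.isRichAction.exists_split fun h => hs (compl_eq_bot.1 h)
    have hdisj : Disjoint (p ⊔ q) (s⁻¹ • ⊤) := hsplit ▸ disjoint_compl_left
    obtain ⟨hps, hqs⟩ := disjoint_sup_left.1 hdisj
    have hcorner : ∀ c d : Idem S, d ≠ ⊥ → Disjoint d c → Disjoint d (s⁻¹ • ⊤) →
        (c.1 * s)⁻¹ • (⊤ : Idem S) ⊔ (c.1 * s) • ⊤ ≠ ⊤ := by
      intro c d hd hdc hds htop
      have h1 : (c.1 * s)⁻¹ • (⊤ : Idem S) ≤ s⁻¹ • ⊤ := by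
        rw [mul_inv_rev_eq, mul_smul]
        exact Idem.smul_mono _ le_top
      have h2 : (c.1 * s) • (⊤ : Idem S) ≤ c := by
        rw [mul_smul, Idem.smul_eq_inf]
        exact inf_le_left
      have h3 := disjoint_sup_right.2 ⟨hds.mono_right h1, hdc.mono_right h2⟩
      rw [htop, disjoint_top] at h3
      exact hd h3
    refine ⟨p.1 * s, pᶜ.1 * s, ⟨?_, ?_⟩, ?_, hcorner p q hq hpq.symm hqs,
      hcorner pᶜ p hp disjoint_compl_right hps⟩
    · have h : (p.1 * (s * s⁻¹)) * pᶜ.1 = 0 := by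
        rw [idem_comm p.2 (mul_inv_self_idem s), mul_assoc, p.mul_compl_val, mul_zero']
      rw [mul_inv_rev_eq, inv_eq_of_idem pᶜ.2, ← h]
      simp only [mul_assoc]
    · rw [mul_inv_rev_eq, inv_eq_of_idem p.2, mul_assoc, ← mul_assoc p.1, p.mul_compl_val,
        zero_mul', mul_zero']
    · rw [← sup_mul _ _ _ (compat_of_idem p.2 pᶜ.2), p.sup_compl_val, one_mul]
  rcases hs with hs | hs
  · exact key s hs
  · obtain ⟨a, b, hab, hsab, ha, hb⟩ := key s⁻¹ (by rwa [inv_inv_eq])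
    refine ⟨a⁻¹, b⁻¹, hab.inv, ?_, ?_, ?_⟩
    · rw [← sup_inv hab, ← hsab, inv_inv_eq]
    · rwa [inv_inv_eq, sup_comm]
    · rwa [inv_inv_eq, sup_comm]

/-- Every element is a join of two orthogonal elements, each below a unit. -/
theorem _root_.CongruenceFree.exists_sup_eq [Infinite S] (hS : CongruenceFree S) (s : S) :
    ∃ (g h : Sˣ) (e f : Idem S), Disjoint e f ∧ Orth (g * e.1) (h * f.1) ∧
      s = sup (g * e.1) (h * f.1) := by
  by_cases hs : s⁻¹ • (⊤ : Idem S) ≠ ⊤ ∨ s • (⊤ : Idem S) ≠ ⊤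
  · obtain ⟨a, b, hab, rfl, ha, hb⟩ := hS.exists_orth_sup_eq hs
    obtain ⟨g, hg⟩ := hS.exists_unit_of_sup_ne_top (Idem.inv_smul_top_val a).symm
      (Idem.smul_top_val a).symm ha
    obtain ⟨h, hh⟩ := hS.exists_unit_of_sup_ne_top (Idem.inv_smul_top_val b).symm
      (Idem.smul_top_val b).symm hb
    refine ⟨g, h, a⁻¹ • ⊤, b⁻¹ • ⊤, ?_, by rwa [← hg, ← hh], by rw [← hg, ← hh]⟩
    rw [Idem.disjoint_iff_mul, Idem.inv_smul_top_val, Idem.inv_smul_top_val, mul_assoc,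
      ← mul_assoc a, hab.1, zero_mul', mul_zero']
  · push Not at hs
    have hd := congrArg Idem.val hs.1
    have hr := congrArg Idem.val hs.2
    rw [Idem.inv_smul_top_val] at hd
    rw [Idem.smul_top_val] at hr
    refine ⟨⟨s, s⁻¹, hr, hd⟩, 1, ⊤, ⊥, disjoint_bot_right, ?_, ?_⟩
    · rw [Idem.bot_val, mul_zero']
      exact orth_zero_right _
    · rw [Idem.bot_val, mul_zero', sup_zero_right, Idem.top_val, mul_one]

/-- Under an order isomorphism of idempotents that is equivariant for the groups of units, every
element has a counterpart acting in the same way. -/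
theorem exists_smul_eq {T : Type u} [BooleanInverseMonoid T] [Infinite S] (hS : CongruenceFree S)
    (θ : Sˣ ≃* Tˣ) (α : Idem S ≃o Idem T) (hα : ∀ (g : Sˣ) (e : Idem S), α (g • e) = θ g • α e)
    (s : S) : ∃ t : T, ∀ e : Idem S, α (s • e) = t • α e := by
  obtain ⟨g, h, e, f, hef, horth, rfl⟩ := hS.exists_sup_eq s
  have hpiece : ∀ (g : Sˣ) (e x : Idem S), α ((g * e.1) • x) = (θ g * (α e).1) • α x :=
    fun g e x => by
      rw [mul_smul, mul_smul, Idem.smul_eq_inf, Idem.smul_eq_inf, ← α.map_inf]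
      exact hα g (e ⊓ x)
  have horth' : Orth (θ g * (α e).1) (θ h * (α f).1) := by
    constructor
    · rw [mul_inv_rev_eq, inv_eq_of_idem (α f).2, mul_assoc, ← mul_assoc (α e).1,
        Idem.disjoint_iff_mul.1 (hef.map_orderIso α), zero_mul', mul_zero']
    · refine inv_mul_eq_zero_of_range ?_
      rw [← Idem.smul_top_val, ← Idem.smul_top_val, ← α.map_top, ← hpiece, ← hpiece,
        ← Idem.disjoint_iff_mul]
      refine (Idem.disjoint_iff_mul.2 ?_).map_orderIso α
      rw [Idem.smul_top_val, Idem.smul_top_val, mul_assoc, ← mul_assoc (_⁻¹), horth.2, zero_mul',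
        mul_zero']
  refine ⟨sup (θ g * (α e).1) (θ h * (α f).1), fun x => ?_⟩
  rw [Idem.sup_smul horth, Idem.sup_smul horth', α.map_sup, hpiece, hpiece]

theorem nonempty_mulEquiv {T : Type u} [BooleanInverseMeetMonoid T] [Infinite S] [Infinite T]
    (hS : CongruenceFree S) (hT : CongruenceFree T) (θ : Sˣ ≃* Tˣ) : Nonempty (S ≃* T) := by
  obtain ⟨α, hα⟩ := hS.isRichAction.exists_equivariant_orderIso hT.isRichAction θ
  choose F hF using exists_smul_eq hS θ α hα
  have hα' : ∀ (g : Tˣ) (e : Idem T), α.symm (g • e) = θ.symm g • α.symm e := fun g e => by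
    rw [OrderIso.symm_apply_eq, hα, θ.apply_symm_apply, α.apply_symm_apply]
  choose F' hF' using exists_smul_eq hT θ.symm α.symm hα'
  refine ⟨⟨⟨F, F', fun s => ?_, fun t => ?_⟩, fun s t => ?_⟩⟩
  · refine hS.eq_of_smul_eq fun e => ?_
    have h := hF' (F s) (α e)
    rwa [← hF, α.symm_apply_apply, α.symm_apply_apply, eq_comm] at h
  · refine hT.eq_of_smul_eq fun e => ?_
    have h := hF (F' t) (α.symm e)
    rwa [← hF', α.apply_symm_apply, α.apply_symm_apply, eq_comm] at h
  · refine hT.eq_of_smul_eq fun e => ?_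
    obtain ⟨e, rfl⟩ := α.surjective e
    change F (s * t) • α e = (F s * F t) • α e
    rw [mul_smul, ← hF, ← hF, ← hF, mul_smul]

end CongruenceFree

end UnitReconstruction

/-- Two countably infinite congruence-free Boolean inverse
∧-monoids are isomorphic iff their groups of units are isomorphic. -/
theorem statement1 (S T : Type u) [BooleanInverseMeetMonoid S] [BooleanInverseMeetMonoid T]
    [Countable S] [Infinite S] [Countable T] [Infinite T]
    (hS : CongruenceFree S) (hT : CongruenceFree T) :
    Nonempty (S ≃* T) ↔ Nonempty (Sˣ ≃* Tˣ) :=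
  ⟨fun ⟨φ⟩ => ⟨Units.mapEquiv φ⟩, fun ⟨θ⟩ => UnitReconstruction.nonempty_mulEquiv hS hT θ⟩
end
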